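/- Assume D is lenticular (γ₁ convex and γ₂ concave on I) and ζ < (√721 − 25)/48; let D^r = π^r(R_φ), u^r : D^r → ℝ the locally Lipschitz function with R_φ = S^r_{u^r}, and E = E^r_{u^r} = {(s, y, t − 2ys) : (y,t) ∈ D^r, s > u^r(y,t)} its right intrinsic epigraph. Then E minimizes the horizontal perimeter in the right cylinder V·D^r: for every Lebesgue-measurable set F ⊂ ℝ³ whose symmetric difference E Δ F is compactly contained in V·D^r, P_H(E; V·D^r) ≤ P_H(F; V·D^r). -/

import Mathlib

open Set MeasureTheory ENNReal

noncomputable section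

/-- `Q_φ(s,λ) = λ - s + 2(γ₂(λ) - γ₁(s))(φ₂(λ) + φ₁(s))` from the paper. -/
def Qphi (γ₁ γ₂ φ₁ φ₂ : ℝ → ℝ) (s l : ℝ) : ℝ :=
  l - s + 2 * (γ₂ l - γ₁ s) * (φ₂ l + φ₁ s)

/-- The boundary curve `p(s) = (φ(s), γ(s), s + 2γ(s)φ(s))` in `ℝ³ ≅ ℍ`. -/
def heisP (γ φ : ℝ → ℝ) (s : ℝ) : ℝ × ℝ × ℝ :=
  (φ s, γ s, s + 2 * γ s * φ s)

/-- The ruled parametrization `ρ(h,s) = (1-h)·p₁(s) + h·p₂(λ(s))`. -/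
def heisRho (γ₁ γ₂ φ₁ φ₂ lam : ℝ → ℝ) (w : ℝ × ℝ) : ℝ × ℝ × ℝ :=
  (1 - w.1) • heisP γ₁ φ₁ w.2 + w.1 • heisP γ₂ φ₂ (lam w.2)

/-- The lenticular domain `D = {(y,t) : t ∈ (0,t̄), γ₁(t) < y < γ₂(t)}`. -/
def lensD (γ₁ γ₂ : ℝ → ℝ) (tb : ℝ) : Set (ℝ × ℝ) :=
  {w | w.2 ∈ Set.Ioo 0 tb ∧ γ₁ w.2 < w.1 ∧ w.1 < γ₂ w.2}

/-- Projection onto `W = {x = 0}` along the integral curves of the right-invariant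
field `X^r = ∂_x - 2y∂_t`: `π^r(x,y,t) = (y, t + 2xy)`. -/
def piR (p : ℝ × ℝ × ℝ) : ℝ × ℝ := (p.2.1, p.2.2 + 2 * p.1 * p.2.1)

/-- The horizontal divergence `Xv₁ + Yv₂` of a `C¹` horizontal section `(v₁, v₂)`,
where `X = ∂_x + 2y∂_t` and `Y = ∂_y - 2x∂_t`. -/
def hDiv (v₁ v₂ : ℝ × ℝ × ℝ → ℝ) (p : ℝ × ℝ × ℝ) : ℝ :=
  fderiv ℝ v₁ p (1, 0, 2 * p.2.1) + fderiv ℝ v₂ p (0, 1, -(2 * p.1))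

/-- The horizontal (H-)perimeter of `E` in the open set `Ω`:
`P_H(E;Ω) = sup {∫_E (Xv₁ + Yv₂) : v₁, v₂ ∈ C¹_c(Ω), v₁² + v₂² ≤ 1}`. -/
def PerH (E Ω : Set (ℝ × ℝ × ℝ)) : ℝ≥0∞ :=
  sSup {m : ℝ≥0∞ | ∃ v₁ v₂ : ℝ × ℝ × ℝ → ℝ,
    ContDiff ℝ 1 v₁ ∧ ContDiff ℝ 1 v₂ ∧
    HasCompactSupport v₁ ∧ HasCompactSupport v₂ ∧
    tsupport v₁ ⊆ Ω ∧ tsupport v₂ ⊆ Ω ∧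
    (∀ p, (v₁ p) ^ 2 + (v₂ p) ^ 2 ≤ 1) ∧
    m = ENNReal.ofReal (∫ p in E, hDiv v₁ v₂ p)}

/-- Mollification of a Lipschitz function: the smooth approximations converge pointwise, their
gradients are uniformly bounded and converge almost everywhere. -/
theorem LipschitzWith.exists_contDiff_approx {V : Type*} [NormedAddCommGroup V] [NormedSpace ℝ V]
    [FiniteDimensional ℝ V] [MeasurableSpace V] [BorelSpace V]
    (μ : Measure V) [μ.IsAddHaarMeasure] {C : NNReal} {M : V → ℝ}
    (hM : LipschitzWith C M) :
    ∃ A : ℕ → V → ℝ, (∀ k, ContDiff ℝ 1 (A k)) ∧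
      (∀ p, Filter.Tendsto (fun k => A k p) Filter.atTop (nhds (M p))) ∧
      (∀ k p, |A k p| ≤ |M p| + C) ∧
      (∀ k p, ‖fderiv ℝ (A k) p‖ ≤ C) ∧
      (∀ᵐ p ∂μ, Filter.Tendsto (fun k => fderiv ℝ (A k) p) Filter.atTop
        (nhds (fderiv ℝ M p))) := by
  let φ : ℕ → ContDiffBump (0 : V) := fun k =>
    ⟨1 / (2 * (k + 1)), 1 / (k + 1), by positivity, by
      apply one_div_lt_one_div_of_lt <;> linarith [(Nat.cast_nonneg k : (0 : ℝ) ≤ k)]⟩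
  let A : ℕ → V → ℝ := fun k => convolution ((φ k).normed μ) M (ContinuousLinearMap.lsmul ℝ ℝ) μ
  have hbd : ∀ p, ‖fderiv ℝ M p‖ ≤ C := fun p => norm_fderiv_le_of_lipschitz ℝ hM
  have hout : Filter.Tendsto (fun k => (φ k).rOut) Filter.atTop (nhds 0) :=
    tendsto_one_div_add_atTop_nhds_zero_nat
  have hcont : ∀ k, Continuous ((φ k).normed μ) := fun k => ((φ k).contDiff_normed (n := 1)).continuous
  have hder : ∀ k p, HasFDerivAt (A k)
      (convolution ((φ k).normed μ) (fderiv ℝ M) (ContinuousLinearMap.lsmul ℝ ℝ) μ p) p := by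
    intro k p
    refine (hasFDerivAt_integral_of_dominated_loc_of_lip (μ := μ) (s := Set.univ)
      (F := fun p q => (φ k).normed μ q • M (p - q))
      (F' := fun q => (φ k).normed μ q • fderiv ℝ M (p - q))
      (bound := fun q => (φ k).normed μ q * C) Filter.univ_mem ?_ ?_ ?_ ?_ ?_ ?_).2
    · exact Filter.Eventually.of_forall fun x =>
        ((hcont k).smul (hM.continuous.comp (continuous_const.sub continuous_id))).aestronglyMeasurable
    · exact ((hcont k).smul (hM.continuous.comp
        (continuous_const.sub continuous_id))).integrable_of_hasCompactSupport
        ((φ k).hasCompactSupport_normed.smul_right)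
    · exact ((hcont k).measurable.smul ((measurable_fderiv ℝ M).comp
        (measurable_const.sub measurable_id))).aestronglyMeasurable
    · refine Filter.Eventually.of_forall fun q => ?_
      refine (LipschitzWith.of_dist_le_mul fun x y => ?_).lipschitzOnWith
      have h := hM.dist_le_mul (x - q) (y - q)
      have h0 := (φ k).nonneg_normed (μ := μ) q
      rw [dist_sub_right] at h
      simp only [dist_eq_norm, smul_eq_mul, ← mul_sub, norm_mul, Real.coe_nnabs] at h ⊢
      rw [Real.norm_of_nonneg h0, abs_of_nonneg (by positivity), mul_assoc]
      gcongr
    · exact ((φ k).integrable_normed).mul_const _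
    · have h1 := hM.ae_differentiableAt (μ := μ)
      have h2 : Filter.Tendsto (fun q => p - q) (ae μ) (ae μ) :=
        (quasiMeasurePreserving_sub_left μ p).tendsto_ae
      filter_upwards [h2.eventually h1] with q hq
      have := hq.hasFDerivAt.comp p ((hasFDerivAt_id p).sub_const q)
      have h3 := this.const_smul ((φ k).normed μ q)
      rw [ContinuousLinearMap.comp_id] at h3
      exact h3
  have hcd : ∀ k, ContDiff ℝ 1 (A k) := fun k =>
    (φ k).hasCompactSupport_normed.contDiff_convolution_left _ (φ k).contDiff_normed
      hM.continuous.locallyIntegrable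
  refine ⟨A, hcd, fun p => ?_, fun k p => ?_, fun k p => ?_, ?_⟩
  · exact ContDiffBump.convolution_tendsto_right_of_continuous hout hM.continuous p
  · have h := ContDiffBump.dist_normed_convolution_le (φ := φ k) (μ := μ) (g := M) (x₀ := p) (ε := C)
      hM.continuous.aestronglyMeasurable (fun x hx => by
        have := hM.dist_le_mul x p
        have h1 : (φ k).rOut ≤ 1 := by
          change 1 / ((k : ℝ) + 1) ≤ 1
          rw [div_le_one (by positivity)]; linarith [(Nat.cast_nonneg k : (0 : ℝ) ≤ k)]
        rw [Metric.mem_ball] at hx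
        refine this.trans ?_
        have := C.2
        nlinarith [C.coe_nonneg])
    have h' : |A k p - M p| ≤ C := h
    have := abs_sub_abs_le_abs_sub (A k p) (M p)
    linarith
  · rw [(hder k p).fderiv]
    refine (norm_integral_le_of_norm_le (((φ k).integrable_normed (μ := μ)).mul_const (C : ℝ))
      (Filter.Eventually.of_forall fun q => ?_)).trans ?_
    · have h0 := (φ k).nonneg_normed (μ := μ) q
      simp only [ContinuousLinearMap.lsmul_apply]
      rw [norm_smul, Real.norm_of_nonneg h0]
      gcongr
      exact hbd _
    · rw [integral_mul_const, (φ k).integral_normed, one_mul]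
  · have hloc : LocallyIntegrable (fderiv ℝ M) μ :=
      (memLp_top_of_bound (measurable_fderiv ℝ M).aestronglyMeasurable C
        (Filter.Eventually.of_forall hbd)).locallyIntegrable le_top
    have := ContDiffBump.ae_convolution_tendsto_right_of_locallyIntegrable (φ := φ)
      (l := Filter.atTop) (K := 2) (μ := μ) hout (Filter.Eventually.of_forall fun k => by
        change 1 / ((k : ℝ) + 1) ≤ 2 * (1 / (2 * (k + 1)))
        apply le_of_eq; field_simp) hloc
    filter_upwards [this] with p hp
    simp_rw [fun k => (hder k p).fderiv]
    exact hp

theorem LipschitzWith.integrable_fderiv_mul {V : Type*} [NormedAddCommGroup V] [NormedSpace ℝ V]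
    [MeasurableSpace V] [BorelSpace V] [FiniteDimensional ℝ V]
    {μ : Measure V} [IsFiniteMeasureOnCompacts μ] {C : NNReal} {G g : V → ℝ}
    (hG : LipschitzWith C G) (hg : Continuous g) (hgs : HasCompactSupport g) (w : V) :
    Integrable (fun p => fderiv ℝ G p w * g p) μ :=
  (hg.integrable_of_hasCompactSupport hgs).bdd_mul (c := C * ‖w‖)
    (measurable_fderiv_apply_const ℝ G w).aestronglyMeasurable
    (Filter.Eventually.of_forall fun p => ((fderiv ℝ G p).le_opNorm w).trans
      (mul_le_mul_of_nonneg_right (norm_fderiv_le_of_lipschitz ℝ hG) (norm_nonneg _)))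

theorem Continuous.integrable_mul_fderiv {V : Type*} [NormedAddCommGroup V] [NormedSpace ℝ V]
    [MeasurableSpace V] [OpensMeasurableSpace V] {μ : Measure V} [IsFiniteMeasureOnCompacts μ]
    {G g : V → ℝ} (hG : Continuous G) (hg : ContDiff ℝ 1 g) (hgs : HasCompactSupport g) (w : V) :
    Integrable (fun p => G p * _root_.fderiv ℝ g p w) μ :=
  (hG.mul ((hg.continuous_fderiv one_ne_zero).clm_apply continuous_const)
    ).integrable_of_hasCompactSupport (hgs.fderiv_apply ℝ w).mul_left

theorem LipschitzWith.integral_mul_fderiv {V : Type*} [NormedAddCommGroup V] [NormedSpace ℝ V]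
    [FiniteDimensional ℝ V] [MeasurableSpace V] [BorelSpace V] (μ : Measure V) [μ.IsAddHaarMeasure]
    {C : NNReal} {G g : V → ℝ} (hG : LipschitzWith C G) (hg : ContDiff ℝ 1 g)
    (hgs : HasCompactSupport g) (w : V) :
    ∫ p, G p * fderiv ℝ g p w ∂μ = -∫ p, fderiv ℝ G p w * g p ∂μ := by
  obtain ⟨D, hD⟩ := hg.lipschitzWith_of_hasCompactSupport hgs one_ne_zero
  have h := hG.integral_lineDeriv_mul_eq (μ := μ) hD hgs w
  have h1 : ∫ p, fderiv ℝ G p w * g p ∂μ = ∫ p, lineDeriv ℝ G p w * g p ∂μ := by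
    refine integral_congr_ae ?_
    filter_upwards [hG.ae_differentiableAt (μ := μ)] with p hp
    rw [hp.lineDeriv_eq_fderiv]
  rw [h1, h, ← integral_neg]
  congr 1
  ext p
  rw [(hg.differentiable one_ne_zero p).lineDeriv_eq_fderiv, map_neg]
  ring

instance isAddHaarMeasure_volume_heisenberg :
    (volume : Measure (ℝ × ℝ × ℝ)).IsAddHaarMeasure :=
  haveI : (volume : Measure (ℝ × ℝ)).IsAddHaarMeasure :=
    Measure.prod.instIsAddHaarMeasure (volume : Measure ℝ) (volume : Measure ℝ)
  Measure.prod.instIsAddHaarMeasure (volume : Measure ℝ) (volume : Measure (ℝ × ℝ))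

theorem fderiv_horizontalX (z : ℝ × ℝ × ℝ → ℝ) (p : ℝ × ℝ × ℝ) (c : ℝ) :
    fderiv ℝ z p (1, 0, c) = fderiv ℝ z p (1, 0, 0) + c * fderiv ℝ z p (0, 0, 1) := by
  rw [← smul_eq_mul, ← map_smul, ← map_add]
  simp

theorem fderiv_horizontalY (z : ℝ × ℝ × ℝ → ℝ) (p : ℝ × ℝ × ℝ) (c : ℝ) :
    fderiv ℝ z p (0, 1, c) = fderiv ℝ z p (0, 1, 0) + c * fderiv ℝ z p (0, 0, 1) := by
  rw [← smul_eq_mul, ← map_smul, ← map_add]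
  simp

/-- Horizontal integration by parts for a Lipschitz function against a `C¹` field. -/
theorem LipschitzWith.integral_mul_hDiv {C : NNReal} {G v₁ v₂ : ℝ × ℝ × ℝ → ℝ}
    (hG : LipschitzWith C G) (h₁ : ContDiff ℝ 1 v₁) (h₂ : ContDiff ℝ 1 v₂)
    (hs₁ : HasCompactSupport v₁) (hs₂ : HasCompactSupport v₂) :
    ∫ p, G p * hDiv v₁ v₂ p =
      -∫ p, (fderiv ℝ G p (1, 0, 2 * p.2.1) * v₁ p + fderiv ℝ G p (0, 1, -(2 * p.1)) * v₂ p) := by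
  let a : ℝ × ℝ × ℝ → ℝ := fun p => 2 * p.2.1
  let b : ℝ × ℝ × ℝ → ℝ := fun p => -(2 * p.1)
  have ha : ContDiff ℝ 1 a := by fun_prop
  have hb : ContDiff ℝ 1 b := by fun_prop
  have ha' : ∀ p, HasFDerivAt a
      ((2 : ℝ) • (ContinuousLinearMap.fst ℝ ℝ ℝ).comp (ContinuousLinearMap.snd ℝ ℝ (ℝ × ℝ))) p :=
    fun p => ((ContinuousLinearMap.fst ℝ ℝ ℝ).comp
      (ContinuousLinearMap.snd ℝ ℝ (ℝ × ℝ))).hasFDerivAt.const_smul (2 : ℝ)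
  have hb' : ∀ p, HasFDerivAt b (-((2 : ℝ) • ContinuousLinearMap.fst ℝ ℝ (ℝ × ℝ))) p :=
    fun p => ((ContinuousLinearMap.fst ℝ ℝ (ℝ × ℝ)).hasFDerivAt.const_smul (2 : ℝ)).neg
  have hda : ∀ p, fderiv ℝ (fun q => a q * v₁ q) p (0, 0, 1) = a p * fderiv ℝ v₁ p (0, 0, 1) := by
    intro p
    have := ((ha' p).mul (h₁.differentiable one_ne_zero p).hasFDerivAt).fderiv
    rw [show (fun q => a q * v₁ q) = a * v₁ from rfl, this]
    simp
  have hdb : ∀ p, fderiv ℝ (fun q => b q * v₂ q) p (0, 0, 1) = b p * fderiv ℝ v₂ p (0, 0, 1) := by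
    intro p
    have := ((hb' p).mul (h₂.differentiable one_ne_zero p).hasFDerivAt).fderiv
    rw [show (fun q => b q * v₂ q) = b * v₂ from rfl, this]
    simp
  have I₁ := hG.integral_mul_fderiv volume h₁ hs₁ (1, 0, 0)
  have I₂ := hG.integral_mul_fderiv volume (ha.mul h₁) hs₁.mul_left (0, 0, 1)
  have I₃ := hG.integral_mul_fderiv volume h₂ hs₂ (0, 1, 0)
  have I₄ := hG.integral_mul_fderiv volume (hb.mul h₂) hs₂.mul_left (0, 0, 1)
  have J₁ := hG.continuous.integrable_mul_fderiv (μ := volume) h₁ hs₁ (1, 0, 0)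
  have J₂ := hG.continuous.integrable_mul_fderiv (μ := volume) (ha.mul h₁) hs₁.mul_left (0, 0, 1)
  have J₃ := hG.continuous.integrable_mul_fderiv (μ := volume) h₂ hs₂ (0, 1, 0)
  have J₄ := hG.continuous.integrable_mul_fderiv (μ := volume) (hb.mul h₂) hs₂.mul_left (0, 0, 1)
  have K₁ := hG.integrable_fderiv_mul (μ := volume) h₁.continuous hs₁ (1, 0, 0)
  have K₂ := hG.integrable_fderiv_mul (μ := volume) (ha.mul h₁).continuous hs₁.mul_left (0, 0, 1)
  have K₃ := hG.integrable_fderiv_mul (μ := volume) h₂.continuous hs₂ (0, 1, 0)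
  have K₄ := hG.integrable_fderiv_mul (μ := volume) (hb.mul h₂).continuous hs₂.mul_left (0, 0, 1)
  have L := integral_add (J₁.add J₂) (J₃.add J₄)
  have R := integral_add (K₁.add K₂) (K₃.add K₄)
  have L₁ := integral_add J₁ J₂
  have L₂ := integral_add J₃ J₄
  have R₁ := integral_add K₁ K₂
  have R₂ := integral_add K₃ K₄
  have e₁ : ∀ p, G p * hDiv v₁ v₂ p = G p * fderiv ℝ v₁ p (1, 0, 0)
      + G p * fderiv ℝ (fun q => a q * v₁ q) p (0, 0, 1)
      + (G p * fderiv ℝ v₂ p (0, 1, 0) + G p * fderiv ℝ (fun q => b q * v₂ q) p (0, 0, 1)) := by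
    intro p
    rw [hda, hdb, hDiv, fderiv_horizontalX, fderiv_horizontalY]
    simp only [a, b]; ring
  have e₂ : ∀ p, fderiv ℝ G p (1, 0, 2 * p.2.1) * v₁ p + fderiv ℝ G p (0, 1, -(2 * p.1)) * v₂ p =
      fderiv ℝ G p (1, 0, 0) * v₁ p + fderiv ℝ G p (0, 0, 1) * (a p * v₁ p)
      + (fderiv ℝ G p (0, 1, 0) * v₂ p + fderiv ℝ G p (0, 0, 1) * (b p * v₂ p)) := by
    intro p
    rw [fderiv_horizontalX, fderiv_horizontalY]
    simp only [a, b]; ring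
  simp_rw [e₁, e₂]
  simp only [Pi.add_apply] at L R L₁ L₂ R₁ R₂
  linarith

/-- The first component of the unit vector in the direction `(1, -r)`. -/
def invNorm (r : ℝ) : ℝ := (Real.sqrt (1 + r ^ 2))⁻¹

theorem invNorm_pos (r : ℝ) : 0 < invNorm r := by
  unfold invNorm; positivity

theorem invNorm_sq (r : ℝ) : invNorm r ^ 2 * (1 + r ^ 2) = 1 := by
  unfold invNorm
  rw [inv_pow, Real.sq_sqrt (by positivity)]
  exact inv_mul_cancel₀ (by positivity)

theorem contDiff_invNorm : ContDiff ℝ 1 invNorm := by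
  unfold invNorm
  exact ((contDiff_const.add (contDiff_id.pow 2)).sqrt fun r => by
    simp only [id]; positivity).inv fun r => by simp only [id]; positivity

theorem hasDerivAt_invNorm (r : ℝ) : HasDerivAt invNorm (-r * invNorm r ^ 3) r := by
  have h1 : HasDerivAt (fun r : ℝ => 1 + r ^ 2) (2 * r) r := by
    simpa using (hasDerivAt_pow 2 r).const_add 1
  have hs : 0 < 1 + r ^ 2 := by positivity
  have h2 := (h1.sqrt hs.ne').inv (Real.sqrt_pos.2 hs).ne'
  refine h2.congr_deriv ?_
  unfold invNorm
  have := Real.sqrt_pos.2 hs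
  field_simp

theorem hasDerivAt_mul_invNorm (r : ℝ) :
    HasDerivAt (fun r => r * invNorm r) (invNorm r ^ 3) r := by
  refine ((hasDerivAt_id r).mul (hasDerivAt_invNorm r)).congr_deriv ?_
  simp only [id]
  linear_combination (-invNorm r) * invNorm_sq r

theorem abs_mul_invNorm_le (r : ℝ) : |r| * invNorm r ≤ 1 := by
  have h := invNorm_sq r
  have h2 := invNorm_pos r
  refine abs_le_of_sq_le_sq' ?_ zero_le_one |>.2
  rw [mul_pow, sq_abs]
  nlinarith [sq_nonneg (invNorm r)]

theorem invNorm_le_one (r : ℝ) : invNorm r ≤ 1 := by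
  have h := invNorm_sq r
  have h2 := invNorm_pos r
  refine abs_le_of_sq_le_sq' ?_ zero_le_one |>.2
  nlinarith [sq_nonneg (invNorm r * r)]

/-- The value `⟨∇_H χ, ν⟩` where `ν` is the unit vector in the direction `(1, -M)`. -/
def calibDiv (χ M : ℝ × ℝ × ℝ → ℝ) (p : ℝ × ℝ × ℝ) : ℝ :=
  invNorm (M p) * fderiv ℝ χ p (1, 0, 2 * p.2.1)
    - M p * invNorm (M p) * fderiv ℝ χ p (0, 1, -(2 * p.1))

theorem hDiv_calibration {χ M : ℝ × ℝ × ℝ → ℝ} {p : ℝ × ℝ × ℝ} (hχ : DifferentiableAt ℝ χ p)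
    (hM : DifferentiableAt ℝ M p) :
    hDiv (fun q => χ q * invNorm (M q)) (fun q => -(χ q * (M q * invNorm (M q)))) p =
      calibDiv χ M p - χ p * invNorm (M p) ^ 3 *
        (M p * fderiv ℝ M p (1, 0, 2 * p.2.1) + fderiv ℝ M p (0, 1, -(2 * p.1))) := by
  have h1 := hχ.hasFDerivAt.mul ((hasDerivAt_invNorm (M p)).comp_hasFDerivAt p hM.hasFDerivAt)
  have h2 := (hχ.hasFDerivAt.mul
    ((hasDerivAt_mul_invNorm (M p)).comp_hasFDerivAt p hM.hasFDerivAt)).neg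
  have e1 : fderiv ℝ (fun q => χ q * invNorm (M q)) p = _ := h1.fderiv
  have e2 : fderiv ℝ (fun q => -(χ q * (M q * invNorm (M q)))) p = _ := h2.fderiv
  rw [hDiv, e1, e2, calibDiv]
  simp only [add_apply, smul_apply, neg_apply, smul_eq_mul, Function.comp]
  ring

theorem abs_hDiv_calibration_le {χ M : ℝ × ℝ × ℝ → ℝ} {p : ℝ × ℝ × ℝ}
    (hχ : DifferentiableAt ℝ χ p) (hM : DifferentiableAt ℝ M p) (h0 : 0 ≤ χ p) {C : ℝ}
    (hC : ‖fderiv ℝ M p‖ ≤ C) :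
    |hDiv (fun q => χ q * invNorm (M q)) (fun q => -(χ q * (M q * invNorm (M q)))) p| ≤
      |fderiv ℝ χ p (1, 0, 2 * p.2.1)| + |fderiv ℝ χ p (0, 1, -(2 * p.1))| + χ p *
        (C * (‖((1 : ℝ), (0 : ℝ), 2 * p.2.1)‖ + ‖((0 : ℝ), (1 : ℝ), -(2 * p.1))‖)) := by
  rw [hDiv_calibration hχ hM, calibDiv]
  set a := fderiv ℝ χ p (1, 0, 2 * p.2.1)
  set b := fderiv ℝ χ p (0, 1, -(2 * p.1))
  have hc : |fderiv ℝ M p (1, 0, 2 * p.2.1)| ≤ C * ‖((1 : ℝ), (0 : ℝ), 2 * p.2.1)‖ :=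
    ((fderiv ℝ M p).le_opNorm _).trans (by gcongr)
  have hd : |fderiv ℝ M p (0, 1, -(2 * p.1))| ≤ C * ‖((0 : ℝ), (1 : ℝ), -(2 * p.1))‖ :=
    ((fderiv ℝ M p).le_opNorm _).trans (by gcongr)
  set c := fderiv ℝ M p (1, 0, 2 * p.2.1)
  set d := fderiv ℝ M p (0, 1, -(2 * p.1))
  have n0 := (invNorm_pos (M p)).le
  have n1 := invNorm_le_one (M p)
  have n2 := abs_mul_invNorm_le (M p)
  set n := invNorm (M p)
  have t1 : |n * a| ≤ |a| := by
    rw [abs_mul, abs_of_nonneg n0]; exact mul_le_of_le_one_left (abs_nonneg _) n1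
  have t2 : |M p * n * b| ≤ |b| := by
    rw [abs_mul, abs_mul, abs_of_nonneg n0]; exact mul_le_of_le_one_left (abs_nonneg _) n2
  have t3 : |χ p * n ^ 3 * (M p * c + d)| ≤ χ p * (|c| + |d|) := by
    rw [mul_assoc, abs_mul, abs_of_nonneg h0]
    refine mul_le_mul_of_nonneg_left ?_ h0
    have : n ^ 3 * (M p * c + d) = n ^ 2 * (M p * n * c) + n ^ 3 * d := by ring
    rw [this]
    refine (abs_add_le _ _).trans (add_le_add ?_ ?_)
    · rw [abs_mul, abs_of_nonneg (by positivity), abs_mul (M p * n), abs_mul (M p),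
        abs_of_nonneg n0]
      calc n ^ 2 * (|M p| * n * |c|) ≤ 1 * (1 * |c|) := by
            gcongr; exact pow_le_one₀ n0 n1
        _ = |c| := by ring
    · rw [abs_mul, abs_of_nonneg (by positivity)]
      exact mul_le_of_le_one_left (abs_nonneg _) (pow_le_one₀ n0 n1)
  calc |n * a - M p * n * b - χ p * n ^ 3 * (M p * c + d)|
      ≤ |n * a| + |M p * n * b| + |χ p * n ^ 3 * (M p * c + d)| :=
        (abs_sub _ _).trans (by gcongr; exact abs_sub _ _)
    _ ≤ |a| + |b| + χ p * (|c| + |d|) := by gcongr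
    _ ≤ _ := by rw [mul_add C]; gcongr

theorem continuous_fderiv_horizontal {χ : ℝ × ℝ × ℝ → ℝ} (hχ : ContDiff ℝ 1 χ) :
    (Continuous fun p : ℝ × ℝ × ℝ => fderiv ℝ χ p (1, 0, 2 * p.2.1)) ∧
      Continuous fun p : ℝ × ℝ × ℝ => fderiv ℝ χ p (0, 1, -(2 * p.1)) :=
  ⟨(hχ.continuous_fderiv one_ne_zero).clm_apply (by fun_prop),
    (hχ.continuous_fderiv one_ne_zero).clm_apply (by fun_prop)⟩

theorem fderiv_apply_eq_zero_of_notMem_tsupport {V : Type*} [NormedAddCommGroup V]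
    [NormedSpace ℝ V] {χ : V → ℝ} {p : V} (hp : p ∉ tsupport χ) (w : V) : fderiv ℝ χ p w = 0 := by
  have : fderiv ℝ χ p = 0 := by
    by_contra h
    exact hp (support_fderiv_subset ℝ h)
  simp [this]

theorem integrable_hDiv {v₁ v₂ : ℝ × ℝ × ℝ → ℝ} (h₁ : ContDiff ℝ 1 v₁) (h₂ : ContDiff ℝ 1 v₂)
    (hs₁ : HasCompactSupport v₁) (hs₂ : HasCompactSupport v₂) :
    Integrable (hDiv v₁ v₂) := by
  refine Continuous.integrable_of_hasCompactSupport
    ((continuous_fderiv_horizontal h₁).1.add (continuous_fderiv_horizontal h₂).2) ?_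
  refine HasCompactSupport.add ?_ ?_
  · exact HasCompactSupport.intro hs₁ fun p hp => fderiv_apply_eq_zero_of_notMem_tsupport hp _
  · exact HasCompactSupport.intro hs₂ fun p hp => fderiv_apply_eq_zero_of_notMem_tsupport hp _

/-- Smooth approximations of the calibrating field `χ ν`. -/
theorem exists_calibration_approx {C : NNReal} {χ M : ℝ × ℝ × ℝ → ℝ} (hM : LipschitzWith C M)
    (hχ : ContDiff ℝ 1 χ) (hχs : HasCompactSupport χ) (h0 : ∀ p, 0 ≤ χ p)
    (hchar : ∀ᵐ p : ℝ × ℝ × ℝ, p ∈ tsupport χ →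
      M p * fderiv ℝ M p (1, 0, 2 * p.2.1) + fderiv ℝ M p (0, 1, -(2 * p.1)) = 0) :
    ∃ (q₁ q₂ : ℕ → ℝ × ℝ × ℝ → ℝ) (b : ℝ × ℝ × ℝ → ℝ), Integrable b ∧ ∀ k,
      ContDiff ℝ 1 (q₁ k) ∧ ContDiff ℝ 1 (q₂ k) ∧
      tsupport (q₁ k) ⊆ tsupport χ ∧ tsupport (q₂ k) ⊆ tsupport χ ∧
      (∀ p, (q₁ k p) ^ 2 + (q₂ k p) ^ 2 ≤ χ p ^ 2) ∧
      (∀ p, |hDiv (q₁ k) (q₂ k) p| ≤ b p) ∧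
      (∀ p, Filter.Tendsto (fun k => q₁ k p) Filter.atTop (nhds (χ p * invNorm (M p)))) ∧
      (∀ p, Filter.Tendsto (fun k => q₂ k p) Filter.atTop
        (nhds (-(χ p * (M p * invNorm (M p)))))) ∧
      ∀ᵐ p : ℝ × ℝ × ℝ, Filter.Tendsto (fun k => hDiv (q₁ k) (q₂ k) p) Filter.atTop
        (nhds (calibDiv χ M p)) := by
  obtain ⟨A, hA, hA1, -, hA3, hA4⟩ := hM.exists_contDiff_approx (volume : Measure (ℝ × ℝ × ℝ))
  have hd : ∀ k p, DifferentiableAt ℝ (A k) p := fun k => (hA k).differentiable one_ne_zero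
  have hdχ : ∀ p, DifferentiableAt ℝ χ p := hχ.differentiable one_ne_zero
  have hN : ∀ p, Filter.Tendsto (fun k => invNorm (A k p)) Filter.atTop
      (nhds (invNorm (M p))) := fun p =>
    (contDiff_invNorm.continuous.tendsto _).comp (hA1 p)
  refine ⟨fun k p => χ p * invNorm (A k p), fun k p => -(χ p * (A k p * invNorm (A k p))),
    fun p => |fderiv ℝ χ p (1, 0, 2 * p.2.1)| + |fderiv ℝ χ p (0, 1, -(2 * p.1))| + χ p *
        (C * (‖((1 : ℝ), (0 : ℝ), 2 * p.2.1)‖ + ‖((0 : ℝ), (1 : ℝ), -(2 * p.1))‖)), ?_,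
    fun k => ⟨?_, ?_, ?_, ?_, ?_, ?_, ?_, ?_, ?_⟩⟩
  · obtain ⟨c1, c2⟩ := continuous_fderiv_horizontal hχ
    refine Continuous.integrable_of_hasCompactSupport ?_ ?_
    · have := hχ.continuous
      fun_prop
    · refine HasCompactSupport.intro hχs fun p hp => ?_
      rw [fderiv_apply_eq_zero_of_notMem_tsupport hp, fderiv_apply_eq_zero_of_notMem_tsupport hp,
        image_eq_zero_of_notMem_tsupport hp]
      simp
  · exact hχ.mul (contDiff_invNorm.comp (hA k))
  · exact (hχ.mul ((hA k).mul (contDiff_invNorm.comp (hA k)))).neg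
  · exact tsupport_mul_subset_left
  · refine closure_mono fun p hp => ?_
    simp only [Function.mem_support, ne_eq, neg_eq_zero, mul_eq_zero, not_or] at hp ⊢
    exact hp.1
  · intro p
    apply le_of_eq
    linear_combination χ p ^ 2 * invNorm_sq (A k p)
  · exact fun p => abs_hDiv_calibration_le (hdχ p) (hd k p) (h0 p) (hA3 k p)
  · exact fun p => (hN p).const_mul _
  · exact fun p => (((hA1 p).mul (hN p)).const_mul _).neg
  · filter_upwards [hchar, hA4] with p hp hp4
    have hX : ∀ w, Filter.Tendsto (fun k => fderiv ℝ (A k) p w) Filter.atTop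
        (nhds (fderiv ℝ M p w)) := fun w =>
      ((ContinuousLinearMap.apply ℝ ℝ w).continuous.tendsto _).comp hp4
    simp_rw [fun k => hDiv_calibration (hdχ p) (hd k p)]
    have hlim : χ p * invNorm (M p) ^ 3 *
        (M p * fderiv ℝ M p (1, 0, 2 * p.2.1) + fderiv ℝ M p (0, 1, -(2 * p.1))) = 0 := by
      by_cases h : p ∈ tsupport χ
      · rw [hp h, mul_zero]
      · rw [image_eq_zero_of_notMem_tsupport h]; ring
    have key := (((hN p).mul_const (fderiv ℝ χ p (1, 0, 2 * p.2.1))).sub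
      (((hA1 p).mul (hN p)).mul_const (fderiv ℝ χ p (0, 1, -(2 * p.1))))).sub
      ((((hN p).pow 3).const_mul (χ p)).mul (((hA1 p).mul (hX (1, 0, 2 * p.2.1))).add
        (hX (0, 1, -(2 * p.1)))))
    rw [hlim, sub_zero] at key
    exact key

/-- Testing the perimeter of an arbitrary measurable set against the calibrating field. -/
theorem ofReal_neg_integral_calibDiv_le_PerH {C : NNReal} {χ M : ℝ × ℝ × ℝ → ℝ}
    {Ω F : Set (ℝ × ℝ × ℝ)} (hM : LipschitzWith C M)
    (hχ : ContDiff ℝ 1 χ) (hχs : HasCompactSupport χ) (h0 : ∀ p, 0 ≤ χ p) (h1 : ∀ p, χ p ≤ 1)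
    (hΩ : tsupport χ ⊆ Ω)
    (hchar : ∀ᵐ p : ℝ × ℝ × ℝ, p ∈ tsupport χ →
      M p * fderiv ℝ M p (1, 0, 2 * p.2.1) + fderiv ℝ M p (0, 1, -(2 * p.1)) = 0) :
    ENNReal.ofReal (-∫ p in F, calibDiv χ M p) ≤ PerH F Ω := by
  obtain ⟨q₁, q₂, b, hb, hq⟩ := exists_calibration_approx hM hχ hχs h0 hchar
  choose hc1 hc2 hs1 hs2 hn hbd _ _ hlim using hq
  have hneg : ∀ k, ∀ p, hDiv (-(q₁ k)) (-(q₂ k)) p = -hDiv (q₁ k) (q₂ k) p := by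
    intro k p
    simp only [hDiv, fderiv_neg, neg_apply]; ring
  have hlim' : Filter.Tendsto (fun k => ∫ p in F, hDiv (-(q₁ k)) (-(q₂ k)) p) Filter.atTop
      (nhds (-∫ p in F, calibDiv χ M p)) := by
    simp_rw [hneg, integral_neg]
    refine (tendsto_integral_of_dominated_convergence b (fun k => ?_) hb.integrableOn
      (fun k => Filter.Eventually.of_forall (hbd k)) (ae_restrict_of_ae (hlim 0))).neg
    exact (integrable_hDiv (hc1 k) (hc2 k) (hχs.of_isClosed_subset (isClosed_tsupport _) (hs1 k))
      (hχs.of_isClosed_subset (isClosed_tsupport _) (hs2 k))).aestronglyMeasurable.restrict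
  refine le_of_tendsto ((ENNReal.continuous_ofReal.tendsto _).comp hlim')
    (Filter.Eventually.of_forall fun k => le_sSup ?_)
  have hts : ∀ q : ℝ × ℝ × ℝ → ℝ, tsupport (-q) = tsupport q := fun q => by
    simp [tsupport, Function.support_neg]
  refine ⟨-(q₁ k), -(q₂ k), (hc1 k).neg, (hc2 k).neg, ?_, ?_, ?_, ?_, fun p => ?_, rfl⟩
  · rw [HasCompactSupport, hts]
    exact hχs.of_isClosed_subset (isClosed_tsupport _) (hs1 k)
  · rw [HasCompactSupport, hts]
    exact hχs.of_isClosed_subset (isClosed_tsupport _) (hs2 k)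
  · rw [hts]; exact (hs1 k).trans hΩ
  · rw [hts]; exact (hs2 k).trans hΩ
  · simp only [Pi.neg_apply, neg_sq]
    exact (hn k p).trans (pow_le_one₀ (h0 p) (h1 p))

theorem exists_lipschitzWith_smoothTransition : ∃ C, LipschitzWith C Real.smoothTransition := by
  have h : LocallyLipschitz Real.smoothTransition :=
    (Real.smoothTransition.contDiff (n := 1)).locallyLipschitz
  obtain ⟨C, hC⟩ := (h.locallyLipschitzOn (s := Icc 0 1)).exists_lipschitzOnWith_of_compact
    isCompact_Icc
  refine ⟨C, LipschitzWith.of_dist_le_mul fun x y => ?_⟩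
  rw [← Real.smoothTransition.projIcc (x := x), ← Real.smoothTransition.projIcc (x := y)]
  refine (hC.dist_le_mul _ (projIcc 0 1 zero_le_one x).2 _ (projIcc 0 1 zero_le_one y).2).trans ?_
  gcongr
  exact (LipschitzWith.projIcc zero_le_one).dist_le_mul x y |>.trans (by simp)

theorem tendsto_smoothTransition_mul (r : ℝ) :
    Filter.Tendsto (fun n : ℕ => Real.smoothTransition ((n : ℝ) * r)) Filter.atTop
      (nhds (if 0 < r then 1 else 0)) := by
  split_ifs with h
  · refine tendsto_const_nhds.congr' ?_
    obtain ⟨m, hm⟩ := exists_nat_ge (1 / r)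
    filter_upwards [Filter.eventually_ge_atTop m] with n hn
    have hmn : (m : ℝ) ≤ n := by exact_mod_cast hn
    rw [Real.smoothTransition.one_of_one_le]
    exact (div_le_iff₀ h).1 (hm.trans hmn)
  · refine tendsto_const_nhds.congr fun n => ?_
    rw [Real.smoothTransition.zero_of_nonpos]
    exact mul_nonpos_of_nonneg_of_nonpos n.cast_nonneg (not_lt.1 h)

theorem neg_mul_sqrt_le {a b c r : ℝ} (hc : 0 ≤ c) (h : a ^ 2 + b ^ 2 ≤ c ^ 2) :
    0 ≤ (a + c * invNorm r) - r * (b + -(c * (r * invNorm r))) := by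
  have hn := invNorm_pos r
  obtain ⟨s, hs⟩ : ∃ s, s = invNorm r * (1 + r ^ 2) := ⟨_, rfl⟩
  have hs0 : 0 < s := by rw [hs]; positivity
  have hss : s ^ 2 = 1 + r ^ 2 := by
    rw [hs]; linear_combination (1 + r ^ 2) * invNorm_sq r
  have h2 : (a - r * b) ^ 2 ≤ (c * s) ^ 2 := by
    rw [mul_pow, hss]
    nlinarith [sq_nonneg (a * r + b), sq_nonneg r]
  have h3 := (abs_le_of_sq_le_sq' h2 (by positivity)).1
  have e : (a + c * invNorm r) - r * (b + -(c * (r * invNorm r))) = a - r * b + c * s := by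
    rw [hs]; ring
  linarith

/-- If `ν` is the horizontal normal of the superlevel set `{f > 0}` and is divergence free, any
horizontal field dominated by `χ` has smaller flux through `{f > 0}` than `-χ ν`. -/
theorem integral_hDiv_add_calibDiv_nonpos {C C' : NNReal} {χ M f v₁ v₂ : ℝ × ℝ × ℝ → ℝ}
    (hM : LipschitzWith C M) (hf : LipschitzWith C' f)
    (hχ : ContDiff ℝ 1 χ) (hχs : HasCompactSupport χ) (h0 : ∀ p, 0 ≤ χ p)
    (h₁ : ContDiff ℝ 1 v₁) (h₂ : ContDiff ℝ 1 v₂)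
    (hs₁ : HasCompactSupport v₁) (hs₂ : HasCompactSupport v₂)
    (hv : ∀ p, v₁ p ^ 2 + v₂ p ^ 2 ≤ χ p ^ 2)
    (hchar : ∀ᵐ p : ℝ × ℝ × ℝ, p ∈ tsupport χ →
      M p * fderiv ℝ M p (1, 0, 2 * p.2.1) + fderiv ℝ M p (0, 1, -(2 * p.1)) = 0)
    (hnor : ∀ᵐ p : ℝ × ℝ × ℝ, p ∈ tsupport χ → 0 ≤ fderiv ℝ f p (1, 0, 2 * p.2.1) ∧
      M p * fderiv ℝ f p (1, 0, 2 * p.2.1) + fderiv ℝ f p (0, 1, -(2 * p.1)) = 0) :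
    ∫ p in {p | 0 < f p}, (hDiv v₁ v₂ p + calibDiv χ M p) ≤ 0 := by
  obtain ⟨q₁, q₂, b, hb, hq⟩ := exists_calibration_approx hM hχ hχs h0 hchar
  choose hc1 hc2 hs1 hs2 hn hbd hl1 hl2 hlim using hq
  have hk1 : ∀ k, HasCompactSupport (q₁ k) := fun k =>
    hχs.of_isClosed_subset (isClosed_tsupport _) (hs1 k)
  have hk2 : ∀ k, HasCompactSupport (q₂ k) := fun k =>
    hχs.of_isClosed_subset (isClosed_tsupport _) (hs2 k)
  have hvi := integrable_hDiv h₁ h₂ hs₁ hs₂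
  have hadd : ∀ k p, hDiv (v₁ + q₁ k) (v₂ + q₂ k) p = hDiv v₁ v₂ p + hDiv (q₁ k) (q₂ k) p := by
    intro k p
    simp only [hDiv]
    rw [fderiv_add (h₁.differentiable one_ne_zero p) ((hc1 k).differentiable one_ne_zero p),
      fderiv_add (h₂.differentiable one_ne_zero p) ((hc2 k).differentiable one_ne_zero p)]
    simp only [add_apply]; ring
  have hbnd : ∀ k p, ‖hDiv (v₁ + q₁ k) (v₂ + q₂ k) p‖ ≤ |hDiv v₁ v₂ p| + b p := fun k p => by
    rw [hadd]; exact (abs_add_le _ _).trans (by gcongr; exact hbd k p)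
  have hdivInt : ∀ k, Integrable (hDiv (v₁ + q₁ k) (v₂ + q₂ k)) := fun k =>
    integrable_hDiv (h₁.add (hc1 k)) (h₂.add (hc2 k)) (hs₁.add (hk1 k)) (hs₂.add (hk2 k))
  have hlim2 : ∀ᵐ p : ℝ × ℝ × ℝ, Filter.Tendsto (fun k => hDiv (v₁ + q₁ k) (v₂ + q₂ k) p)
      Filter.atTop (nhds (hDiv v₁ v₂ p + calibDiv χ M p)) := by
    filter_upwards [hlim 0] with p hp
    simp_rw [hadd]
    exact hp.const_add _
  have hmeas : AEStronglyMeasurable (fun p => hDiv v₁ v₂ p + calibDiv χ M p) volume :=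
    aestronglyMeasurable_of_tendsto_ae _ (fun k => (hdivInt k).aestronglyMeasurable) hlim2
  have hle : ∀ᵐ p : ℝ × ℝ × ℝ, ‖hDiv v₁ v₂ p + calibDiv χ M p‖ ≤ |hDiv v₁ v₂ p| + b p := by
    filter_upwards [hlim2] with p hp
    exact le_of_tendsto hp.norm (Filter.Eventually.of_forall fun k => hbnd k p)
  have hbi : Integrable fun p => |hDiv v₁ v₂ p| + b p := hvi.abs.add hb
  obtain ⟨K, hK⟩ := exists_lipschitzWith_smoothTransition
  let G : ℕ → ℝ × ℝ × ℝ → ℝ := fun n p => Real.smoothTransition ((n : ℝ) * f p)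
  have hG : ∀ n : ℕ, LipschitzWith (K * ((n : NNReal) * C')) (G n) := fun n =>
    hK.comp (LipschitzWith.of_dist_le_mul fun x y => by
      have := hf.dist_le_mul x y
      rw [Real.dist_eq, ← mul_sub, abs_mul, ← Real.dist_eq, abs_of_nonneg n.cast_nonneg]
      push_cast
      rw [mul_assoc]
      gcongr)
  have hG1 : ∀ n p, ‖G n p‖ ≤ 1 := fun n p => by
    rw [Real.norm_of_nonneg (Real.smoothTransition.nonneg _)]
    exact Real.smoothTransition.le_one _
  have hstep : ∀ n, ∫ p, G n p * (hDiv v₁ v₂ p + calibDiv χ M p) ≤ 0 := by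
    intro n
    have L1 : Filter.Tendsto (fun k => ∫ p, G n p * hDiv (v₁ + q₁ k) (v₂ + q₂ k) p) Filter.atTop
        (nhds (∫ p, G n p * (hDiv v₁ v₂ p + calibDiv χ M p))) := by
      refine tendsto_integral_of_dominated_convergence _ (fun k => ?_) hbi
        (fun k => Filter.Eventually.of_forall fun p => ?_) ?_
      · exact (hG n).continuous.aestronglyMeasurable.mul (hdivInt k).aestronglyMeasurable
      · rw [norm_mul]
        exact (mul_le_of_le_one_left (norm_nonneg _) (hG1 n p)).trans (hbnd k p)
      · filter_upwards [hlim2] with p hp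
        exact hp.const_mul _
    let D : NNReal := K * ((n : NNReal) * C')
    have L2 : Filter.Tendsto (fun k => ∫ p, (fderiv ℝ (G n) p (1, 0, 2 * p.2.1) * (v₁ + q₁ k) p +
        fderiv ℝ (G n) p (0, 1, -(2 * p.1)) * (v₂ + q₂ k) p)) Filter.atTop
        (nhds (∫ p, (fderiv ℝ (G n) p (1, 0, 2 * p.2.1) * (v₁ p + χ p * invNorm (M p)) +
          fderiv ℝ (G n) p (0, 1, -(2 * p.1)) * (v₂ p + -(χ p * (M p * invNorm (M p))))))) := by
      refine tendsto_integral_of_dominated_convergence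
        (fun p => D * ‖((1 : ℝ), (0 : ℝ), 2 * p.2.1)‖ * (χ p + χ p) +
          D * ‖((0 : ℝ), (1 : ℝ), -(2 * p.1))‖ * (χ p + χ p)) (fun k => ?_) ?_
        (fun k => Filter.Eventually.of_forall fun p => ?_)
        (Filter.Eventually.of_forall fun p => ?_)
      · have hX : Measurable fun p : ℝ × ℝ × ℝ => fderiv ℝ (G n) p (1, 0, 2 * p.2.1) := by
          rw [show (fun p : ℝ × ℝ × ℝ => fderiv ℝ (G n) p (1, 0, 2 * p.2.1)) = _ from
            funext fun p => fderiv_horizontalX (G n) p _]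
          have := measurable_fderiv_apply_const ℝ (G n) (1, 0, 0)
          have := measurable_fderiv_apply_const ℝ (G n) (0, 0, 1)
          fun_prop
        have hY : Measurable fun p : ℝ × ℝ × ℝ => fderiv ℝ (G n) p (0, 1, -(2 * p.1)) := by
          rw [show (fun p : ℝ × ℝ × ℝ => fderiv ℝ (G n) p (0, 1, -(2 * p.1))) = _ from
            funext fun p => fderiv_horizontalY (G n) p _]
          have := measurable_fderiv_apply_const ℝ (G n) (0, 1, 0)
          have := measurable_fderiv_apply_const ℝ (G n) (0, 0, 1)
          fun_prop
        exact ((hX.mul (h₁.add (hc1 k)).continuous.measurable).add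
          (hY.mul (h₂.add (hc2 k)).continuous.measurable)).aestronglyMeasurable
      · refine Continuous.integrable_of_hasCompactSupport ?_ ?_
        · have := hχ.continuous
          fun_prop
        · refine HasCompactSupport.intro hχs fun p hp => ?_
          rw [image_eq_zero_of_notMem_tsupport hp]; simp
      · have hbX : ∀ w, ‖fderiv ℝ (G n) p w‖ ≤ D * ‖w‖ := fun w =>
          ((fderiv ℝ (G n) p).le_opNorm w).trans (by
            gcongr; exact norm_fderiv_le_of_lipschitz ℝ (hG n))
        have hv1 : |v₁ p| ≤ χ p :=
          abs_le_of_sq_le_sq (by nlinarith [hv p, sq_nonneg (v₂ p)]) (h0 p)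
        have hv2 : |v₂ p| ≤ χ p :=
          abs_le_of_sq_le_sq (by nlinarith [hv p, sq_nonneg (v₁ p)]) (h0 p)
        have hq1 : |q₁ k p| ≤ χ p :=
          abs_le_of_sq_le_sq (by nlinarith [hn k p, sq_nonneg (q₂ k p)]) (h0 p)
        have hq2 : |q₂ k p| ≤ χ p :=
          abs_le_of_sq_le_sq (by nlinarith [hn k p, sq_nonneg (q₁ k p)]) (h0 p)
        refine (norm_add_le _ _).trans (add_le_add ?_ ?_)
        · rw [norm_mul]
          exact mul_le_mul (hbX _) ((abs_add_le _ _).trans (add_le_add hv1 hq1)) (norm_nonneg _)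
            (by positivity)
        · rw [norm_mul]
          exact mul_le_mul (hbX _) ((abs_add_le _ _).trans (add_le_add hv2 hq2)) (norm_nonneg _)
            (by positivity)
      · exact (((hl1 0 p).const_add _).const_mul _).add (((hl2 0 p).const_add _).const_mul _)
    have L3 := L1.congr fun k => (hG n).integral_mul_hDiv (h₁.add (hc1 k)) (h₂.add (hc2 k))
      (hs₁.add (hk1 k)) (hs₂.add (hk2 k))
    rw [tendsto_nhds_unique L3 L2.neg]
    refine neg_nonpos.2 (integral_nonneg_of_ae ?_)
    filter_upwards [hnor, hf.ae_differentiableAt] with p hp hdf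
    by_cases h : p ∈ tsupport χ
    · obtain ⟨hp1, hp2⟩ := hp h
      have hψ : DifferentiableAt ℝ Real.smoothTransition ((n : ℝ) * f p) :=
        (Real.smoothTransition.contDiff (n := 1)).differentiable one_ne_zero _
      have hder := (hψ.hasDerivAt.comp_hasFDerivAt p (hdf.hasFDerivAt.const_mul (n : ℝ))).fderiv
      have hpos : 0 ≤ deriv Real.smoothTransition ((n : ℝ) * f p) :=
        Real.smoothTransition.monotone.deriv_nonneg
      have e : ∀ w, fderiv ℝ (G n) p w =
          deriv Real.smoothTransition ((n : ℝ) * f p) * n * fderiv ℝ f p w := fun w => by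
        change fderiv ℝ (Real.smoothTransition ∘ fun p => (n : ℝ) * f p) p w = _
        rw [hder]; simp [mul_assoc]
      have hs := neg_mul_sqrt_le (r := M p) (h0 p) (hv p)
      rw [e, e, eq_neg_of_add_eq_zero_right hp2]
      have := mul_nonneg (mul_nonneg (mul_nonneg hpos n.cast_nonneg) hp1) hs
      simp only [Pi.zero_apply]
      nlinarith [this]
    · have hχ0 := image_eq_zero_of_notMem_tsupport h
      have hv0 := hv p
      rw [hχ0] at hv0
      have e1 : v₁ p = 0 := by nlinarith [sq_nonneg (v₁ p), sq_nonneg (v₂ p)]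
      have e2 : v₂ p = 0 := by nlinarith [sq_nonneg (v₁ p), sq_nonneg (v₂ p)]
      simp [hχ0, e1, e2]
  have hlimn : Filter.Tendsto (fun n => ∫ p, G n p * (hDiv v₁ v₂ p + calibDiv χ M p)) Filter.atTop
      (nhds (∫ p in {p | 0 < f p}, (hDiv v₁ v₂ p + calibDiv χ M p))) := by
    rw [← integral_indicator (isOpen_lt continuous_const hf.continuous).measurableSet]
    refine tendsto_integral_of_dominated_convergence _ (fun n => ?_) hbi (fun n => ?_)
      (Filter.Eventually.of_forall fun p => ?_)
    · exact (hG n).continuous.aestronglyMeasurable.mul hmeas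
    · filter_upwards [hle] with p hp
      rw [norm_mul]
      exact (mul_le_of_le_one_left (norm_nonneg _) (hG1 n p)).trans hp
    · convert (tendsto_smoothTransition_mul (f p)).mul_const (hDiv v₁ v₂ p + calibDiv χ M p) using 2
      by_cases h : 0 < f p <;> simp [indicator, h]
  exact le_of_tendsto' hlimn hstep

theorem continuous_calibDiv {χ M : ℝ × ℝ × ℝ → ℝ} (hχ : ContDiff ℝ 1 χ) (hM : Continuous M) :
    Continuous (calibDiv χ M) := by
  obtain ⟨h1, h2⟩ := continuous_fderiv_horizontal hχ
  have h3 : Continuous fun p => invNorm (M p) := contDiff_invNorm.continuous.comp hM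
  unfold calibDiv
  fun_prop

theorem integrable_calibDiv {χ M : ℝ × ℝ × ℝ → ℝ} (hχ : ContDiff ℝ 1 χ)
    (hχs : HasCompactSupport χ) (hM : Continuous M) : Integrable (calibDiv χ M) := by
  refine (continuous_calibDiv hχ hM).integrable_of_hasCompactSupport ?_
  refine HasCompactSupport.intro hχs fun p hp => ?_
  rw [calibDiv, fderiv_apply_eq_zero_of_notMem_tsupport hp,
    fderiv_apply_eq_zero_of_notMem_tsupport hp]
  simp

theorem fderiv_apply_eq_zero_of_eventually_line {V : Type*} [NormedAddCommGroup V]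
    [NormedSpace ℝ V] {g : V → ℝ} {p w : V} (hg : DifferentiableAt ℝ g p)
    (h : ∀ᶠ r : ℝ in nhds 0, g (p + r • w) = g p) : fderiv ℝ g p w = 0 := by
  have h1 : HasDerivAt (fun r : ℝ => g (p + r • w)) (fderiv ℝ g p w) 0 :=
    hg.hasFDerivAt.hasLineDerivAt w
  have h2 : HasDerivAt (fun r : ℝ => g (p + r • w)) 0 0 :=
    (hasDerivAt_const (0 : ℝ) (g p)).congr_of_eventuallyEq h
  exact h1.unique h2

theorem fderiv_apply_nonneg_of_eventually_line {V : Type*} [NormedAddCommGroup V]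
    [NormedSpace ℝ V] {g : V → ℝ} {p w : V} (hg : DifferentiableAt ℝ g p)
    (h : ∀ᶠ r : ℝ in nhdsWithin 0 (Ioi 0), g p ≤ g (p + r • w)) : 0 ≤ fderiv ℝ g p w := by
  have h1 : HasDerivAt (fun r : ℝ => g (p + r • w)) (fderiv ℝ g p w) 0 :=
    hg.hasFDerivAt.hasLineDerivAt w
  have h2 := h1.tendsto_slope_zero_right
  refine ge_of_tendsto h2 ?_
  filter_upwards [h, self_mem_nhdsWithin] with r hr hr0
  simp only [zero_add, zero_smul, add_zero, smul_eq_mul]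
  exact mul_nonneg (inv_nonneg.2 (le_of_lt hr0)) (sub_nonneg.2 hr)

/-- A superlevel set whose horizontal normal direction `(1, -M)` is constant along the
characteristic lines in the direction `M X + Y` minimizes the horizontal perimeter. -/
theorem PerH_le_of_calibration {Ω F K : Set (ℝ × ℝ × ℝ)} {f M : ℝ × ℝ × ℝ → ℝ} (hΩ : IsOpen Ω)
    (hf : LocallyLipschitzOn Ω f) (hM : LocallyLipschitzOn Ω M)
    (hcal : ∀ p ∈ Ω, ∀ᶠ r : ℝ in nhds 0,
      f (p + r • (M p, 1, 2 * (p.2.1 * M p - p.1))) = f p ∧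
      M (p + r • (M p, 1, 2 * (p.2.1 * M p - p.1))) = M p)
    (hmono : ∀ p ∈ Ω, ∀ᶠ r : ℝ in nhdsWithin 0 (Ioi 0), f p ≤ f (p + r • (1, 0, 2 * p.2.1)))
    (hF : MeasurableSet F) (hK : IsCompact K)
    (hEK : ({p | p ∈ Ω ∧ 0 < f p} \ F) ∪ (F \ {p | p ∈ Ω ∧ 0 < f p}) ⊆ K) (hKΩ : K ⊆ Ω) :
    PerH {p | p ∈ Ω ∧ 0 < f p} Ω ≤ PerH F Ω := by
  set E := {p | p ∈ Ω ∧ 0 < f p} with hE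
  have hEo : IsOpen E := hf.continuousOn.isOpen_inter_preimage hΩ isOpen_Ioi
  refine sSup_le ?_
  rintro _ ⟨v₁, v₂, h₁, h₂, hs₁, hs₂, ht₁, ht₂, hv, rfl⟩
  have hS : IsCompact (tsupport v₁ ∪ tsupport v₂ ∪ K) :=
    (IsCompact.union hs₁ hs₂).union hK
  obtain ⟨L, hL, hSL, hLΩ⟩ := exists_compact_between hS hΩ (union_subset (union_subset ht₁ ht₂) hKΩ)
  obtain ⟨L', hL', hLL', hL'Ω⟩ := exists_compact_between hL hΩ hLΩ
  obtain ⟨χ, hχ1, hχ0, hχI⟩ := exists_contMDiffMap_one_nhds_of_subset_interior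
    (n := 1) (modelWithCornersSelf ℝ (ℝ × ℝ × ℝ)) hS.isClosed hSL
  have hχ : ContDiff ℝ 1 χ := χ.contMDiff.contDiff
  have htL : tsupport χ ⊆ L := closure_minimal (fun p hp => by
    by_contra h; exact hp (hχ0 p h)) hL.isClosed
  have hχs : HasCompactSupport χ := hL.of_isClosed_subset (isClosed_tsupport _) htL
  obtain ⟨Cf, hCf⟩ := (hf.mono hL'Ω).exists_lipschitzOnWith_of_compact hL'
  obtain ⟨CM, hCM⟩ := (hM.mono hL'Ω).exists_lipschitzOnWith_of_compact hL'
  obtain ⟨f', hf', hff'⟩ := hCf.extend_real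
  obtain ⟨M', hM', hMM'⟩ := hCM.extend_real
  have hnhds : ∀ p ∈ tsupport χ, p ∈ Ω ∧ L' ∈ nhds p := fun p hp =>
    ⟨hLΩ (htL hp), mem_interior_iff_mem_nhds.1 (hLL' (htL hp))⟩
  have hline : ∀ p w : ℝ × ℝ × ℝ, L' ∈ nhds p → ∀ᶠ r : ℝ in nhds 0, p + r • w ∈ L' := by
    intro p w hp
    have : Filter.Tendsto (fun r : ℝ => p + r • w) (nhds 0) (nhds p) := by
      have : Continuous fun r : ℝ => p + r • w := by fun_prop
      simpa using this.tendsto 0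
    exact this hp
  have hdir : ∀ (g : ℝ × ℝ × ℝ → ℝ) (p : ℝ × ℝ × ℝ) (m : ℝ),
      fderiv ℝ g p (m, 1, 2 * (p.2.1 * m - p.1)) =
        m * fderiv ℝ g p (1, 0, 2 * p.2.1) + fderiv ℝ g p (0, 1, -(2 * p.1)) := by
    intro g p m
    rw [← smul_eq_mul m, ← map_smul, ← map_add]
    congr 1
    simp only [Prod.smul_mk, smul_eq_mul, Prod.mk_add_mk, Prod.mk.injEq]
    exact ⟨by ring, by ring, by ring⟩
  have hchar : ∀ᵐ p : ℝ × ℝ × ℝ, p ∈ tsupport χ →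
      M' p * fderiv ℝ M' p (1, 0, 2 * p.2.1) + fderiv ℝ M' p (0, 1, -(2 * p.1)) = 0 := by
    filter_upwards [hM'.ae_differentiableAt] with p hp hpχ
    obtain ⟨hpΩ, hpL⟩ := hnhds p hpχ
    rw [← hdir]
    refine fderiv_apply_eq_zero_of_eventually_line hp ?_
    have e := hMM' (mem_of_mem_nhds hpL)
    rw [← e]
    filter_upwards [hcal p hpΩ, hline p _ hpL] with r hr hrL
    rw [← hMM' hrL, hr.2]
  have hnor : ∀ᵐ p : ℝ × ℝ × ℝ, p ∈ tsupport χ → 0 ≤ fderiv ℝ f' p (1, 0, 2 * p.2.1) ∧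
      M' p * fderiv ℝ f' p (1, 0, 2 * p.2.1) + fderiv ℝ f' p (0, 1, -(2 * p.1)) = 0 := by
    filter_upwards [hf'.ae_differentiableAt] with p hp hpχ
    obtain ⟨hpΩ, hpL⟩ := hnhds p hpχ
    have e := hff' (mem_of_mem_nhds hpL)
    constructor
    · refine fderiv_apply_nonneg_of_eventually_line hp ?_
      filter_upwards [hmono p hpΩ, nhdsWithin_le_nhds (hline p _ hpL)] with r hr hrL
      rw [← hff' hrL, ← e]
      exact hr
    · rw [← hdir]
      refine fderiv_apply_eq_zero_of_eventually_line hp ?_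
      rw [← hMM' (mem_of_mem_nhds hpL), ← e]
      filter_upwards [hcal p hpΩ, hline p _ hpL] with r hr hrL
      rw [← hff' hrL, hr.1]
  have hχS : ∀ p ∈ tsupport v₁ ∪ tsupport v₂ ∪ K, ∀ᶠ q in nhds p, χ q = 1 :=
    fun p hp => Filter.Eventually.filter_mono (nhds_le_nhdsSet hp) hχ1
  have hvχ : ∀ p, v₁ p ^ 2 + v₂ p ^ 2 ≤ χ p ^ 2 := by
    intro p
    by_cases h : p ∈ tsupport v₁ ∪ tsupport v₂
    · rw [(hχS p (Or.inl h)).self_of_nhds]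
      simpa using hv p
    · rw [mem_union, not_or] at h
      rw [image_eq_zero_of_notMem_tsupport h.1, image_eq_zero_of_notMem_tsupport h.2]
      simpa using sq_nonneg (χ p)
  have hDK : ∀ p ∈ K, calibDiv χ M' p = 0 := by
    intro p hp
    have : fderiv ℝ χ p = 0 := by
      rw [Filter.EventuallyEq.fderiv_eq (f := fun _ => (1 : ℝ)) (hχS p (Or.inr hp))]
      simp
    simp [calibDiv, this]
  have hEF : ∫ p in E, calibDiv χ M' p = ∫ p in F, calibDiv χ M' p := by
    rw [← integral_indicator hEo.measurableSet, ← integral_indicator hF]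
    congr 1
    funext p
    by_cases hpE : p ∈ E <;> by_cases hpF : p ∈ F
    · simp [hpE, hpF]
    · simp [hpE, hpF, hDK p (hEK (Or.inl ⟨hpE, hpF⟩))]
    · simp [hpE, hpF, hDK p (hEK (Or.inr ⟨hpF, hpE⟩))]
    · simp [hpE, hpF]
  have hEf : ∫ p in E, (hDiv v₁ v₂ p + calibDiv χ M' p) =
      ∫ p in {p | 0 < f' p}, (hDiv v₁ v₂ p + calibDiv χ M' p) := by
    rw [← integral_indicator hEo.measurableSet,
      ← integral_indicator (isOpen_lt continuous_const hf'.continuous).measurableSet]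
    congr 1
    funext p
    by_cases hp : p ∈ L
    · have e := hff' (interior_subset (hLL' hp))
      have hpΩ := hLΩ hp
      simp only [indicator, hE, mem_ofPred_eq, hpΩ, true_and, e]
    · have hpS : p ∉ tsupport v₁ ∪ tsupport v₂ ∪ K := fun h => hp (interior_subset (hSL h))
      simp only [mem_union, not_or] at hpS
      have hz : hDiv v₁ v₂ p + calibDiv χ M' p = 0 := by
        have hpχ : p ∉ tsupport χ := fun h => hp (htL h)
        simp only [hDiv, calibDiv, fderiv_apply_eq_zero_of_notMem_tsupport hpS.1.1,
          fderiv_apply_eq_zero_of_notMem_tsupport hpS.1.2,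
          fderiv_apply_eq_zero_of_notMem_tsupport hpχ]
        simp
      simp [indicator, hz]
  have hmain := integral_hDiv_add_calibDiv_nonpos hM' hf' hχ hχs (fun p => (hχI p).1) h₁ h₂ hs₁ hs₂
    hvχ hchar hnor
  rw [← hEf, integral_add (integrable_hDiv h₁ h₂ hs₁ hs₂).integrableOn
    (integrable_calibDiv hχ hχs hM'.continuous).integrableOn, hEF] at hmain
  refine le_trans (ENNReal.ofReal_le_ofReal (by linarith)) <|
    ofReal_neg_integral_calibDiv_le_PerH (F := F) hM' hχ hχs (fun p => (hχI p).1)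
      (fun p => (hχI p).2) (htL.trans hLΩ) hchar

/-- The boundary data of a lenticular domain with explicit bounds, together with the
reparametrization `lam` of the upper boundary curve. -/
structure IsLens (tb A B P L : ℝ) (γ₁ γ₂ φ₁ φ₂ lam : ℝ → ℝ) : Prop where
  B_nonneg : 0 ≤ B
  L_nonneg : 0 ≤ L
  small : 4 * (A + B) * (P + L) ≤ 193 / 5000
  lip_gam₁ : ∀ s ∈ Icc 0 tb, ∀ s' ∈ Icc 0 tb, |γ₁ s' - γ₁ s| ≤ B * |s' - s|
  lip_gam₂ : ∀ s ∈ Icc 0 tb, ∀ s' ∈ Icc 0 tb, |γ₂ s' - γ₂ s| ≤ B * |s' - s|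
  lip_phi₁ : ∀ s ∈ Icc 0 tb, ∀ s' ∈ Icc 0 tb, |φ₁ s' - φ₁ s| ≤ L * |s' - s|
  lip_phi₂ : ∀ s ∈ Icc 0 tb, ∀ s' ∈ Icc 0 tb, |φ₂ s' - φ₂ s| ≤ L * |s' - s|
  gam₁_le : ∀ s ∈ Icc 0 tb, |γ₁ s| ≤ A
  gam₂_le : ∀ s ∈ Icc 0 tb, |γ₂ s| ≤ A
  phi₁_le : ∀ s ∈ Icc 0 tb, |φ₁ s| ≤ P
  phi₂_le : ∀ s ∈ Icc 0 tb, |φ₂ s| ≤ P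
  gam₁_neg : ∀ s ∈ Ioo 0 tb, γ₁ s < 0
  gam₂_pos : ∀ s ∈ Ioo 0 tb, 0 < γ₂ s
  gam₁_zero : γ₁ 0 = 0
  gam₁_tb : γ₁ tb = 0
  gam₂_zero : γ₂ 0 = 0
  gam₂_tb : γ₂ tb = 0
  phi_zero : φ₁ 0 = φ₂ 0
  phi_tb : φ₁ tb = φ₂ tb
  convex : ConvexOn ℝ (Icc 0 tb) γ₁
  concave : ConcaveOn ℝ (Icc 0 tb) γ₂
  lam_mem : ∀ s ∈ Icc 0 tb, lam s ∈ Icc 0 tb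
  lam_mono : StrictMonoOn lam (Icc 0 tb)
  lam_sol : ∀ s ∈ Icc 0 tb, Qphi γ₁ γ₂ φ₁ φ₂ s (lam s) = 0
  lam_zero : lam 0 = 0
  lam_tb : lam tb = tb

/-- If `D` is the increment of a convex function vanishing at distance `s` to the left and
`r` to the right, and `a` is at most linear in both distances, then `a * D` is controlled by the
size of the function. -/
theorem abs_mul_abs_le_of_slopes {a b b' c D s r r' Δ : ℝ} (hc : 0 ≤ c) (hb : 0 < b)
    (hr : 0 < r') (hΔ : 0 < Δ) (has : |a| ≤ c * s) (har : |a| ≤ c * r)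
    (h1 : -D * s ≤ Δ * b) (h2 : D * r' ≤ Δ * b') (h0 : 0 < r)
    (h3 : b' * r ≤ 3 / 2 * (b * r')) : |a| * |D| ≤ 3 / 2 * c * Δ * b := by
  rcases le_total 0 D with h | h
  · rw [abs_of_nonneg h]
    have : r * D ≤ 3 / 2 * (Δ * b) := by
      refine le_of_mul_le_mul_right ?_ hr
      nlinarith [mul_le_mul_of_nonneg_left h2 h0.le, mul_le_mul_of_nonneg_left h3 hΔ.le]
    nlinarith [mul_le_mul_of_nonneg_right har h, mul_le_mul_of_nonneg_left this hc]
  · rw [abs_of_nonpos h]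
    have := mul_le_mul_of_nonneg_left h1 hc
    have := mul_nonneg (mul_nonneg hc hΔ.le) hb.le
    nlinarith [mul_le_mul_of_nonneg_right has (neg_nonneg.2 h)]

/-- The width `γ₂(λ(s)) - γ₁(s)` of the projected ruling. -/
def lensWidth (γ₁ γ₂ lam : ℝ → ℝ) (s : ℝ) : ℝ := γ₂ (lam s) - γ₁ s

/-- The slope of the ruling. -/
def lensSlope (γ₁ γ₂ φ₁ φ₂ lam : ℝ → ℝ) (s : ℝ) : ℝ :=
  (φ₂ (lam s) - φ₁ s) / lensWidth γ₁ γ₂ lam s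

/-- The vertical coordinate of the projected ruling. -/
def lensHeight (γ₁ γ₂ φ₁ φ₂ lam : ℝ → ℝ) (s y : ℝ) : ℝ :=
  s + 4 * γ₁ s * φ₁ s + 2 * lensSlope γ₁ γ₂ φ₁ φ₂ lam s * (y ^ 2 - γ₁ s ^ 2)

/-- The first coordinate of the ruling. -/
def lensGraph (γ₁ γ₂ φ₁ φ₂ lam : ℝ → ℝ) (s y : ℝ) : ℝ :=
  φ₁ s + lensSlope γ₁ γ₂ φ₁ φ₂ lam s * (y - γ₁ s)

namespace IsLens

variable {tb A B P L : ℝ} {γ₁ γ₂ φ₁ φ₂ lam : ℝ → ℝ}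

theorem A_nonneg (h : IsLens tb A B P L γ₁ γ₂ φ₁ φ₂ lam) {s : ℝ} (hs : s ∈ Icc 0 tb) : 0 ≤ A :=
  (abs_nonneg _).trans (h.gam₁_le s hs)

theorem P_nonneg (h : IsLens tb A B P L γ₁ γ₂ φ₁ φ₂ lam) {s : ℝ} (hs : s ∈ Icc 0 tb) : 0 ≤ P :=
  (abs_nonneg _).trans (h.phi₁_le s hs)

theorem lam_sub (h : IsLens tb A B P L γ₁ γ₂ φ₁ φ₂ lam) {s s' : ℝ} (hs : s ∈ Icc 0 tb)
    (hs' : s' ∈ Icc 0 tb) (hss : s < s') : 0 < lam s' - lam s ∧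
      lam s' - lam s ≤ 1081 / 1000 * (s' - s) ∧ s' - s ≤ 1081 / 1000 * (lam s' - lam s) := by
  have hA := h.A_nonneg hs
  have hP := h.P_nonneg hs
  have hB := h.B_nonneg
  have hL := h.L_nonneg
  have hl : 0 < lam s' - lam s := sub_pos.2 (h.lam_mono hs hs' hss)
  have hΔ : 0 < s' - s := sub_pos.2 hss
  have q := h.lam_sol s hs
  have q' := h.lam_sol s' hs'
  have g1 := h.lip_gam₁ s hs s' hs'
  have g2 := h.lip_gam₂ _ (h.lam_mem s hs) _ (h.lam_mem s' hs')
  have f1 := h.lip_phi₁ s hs s' hs'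
  have f2 := h.lip_phi₂ _ (h.lam_mem s hs) _ (h.lam_mem s' hs')
  rw [abs_of_pos hl] at g2 f2
  rw [abs_of_pos hΔ] at g1 f1
  have b1 := h.gam₁_le s hs
  have b2 := h.gam₂_le _ (h.lam_mem s hs)
  have c1 := h.phi₁_le s' hs'
  have c2 := h.phi₂_le _ (h.lam_mem s' hs')
  unfold Qphi at q q'
  have e : (lam s' - lam s) - (s' - s) =
      -(2 * (((γ₂ (lam s') - γ₂ (lam s)) - (γ₁ s' - γ₁ s)) * (φ₂ (lam s') + φ₁ s') +
        (γ₂ (lam s) - γ₁ s) * ((φ₂ (lam s') - φ₂ (lam s)) + (φ₁ s' - φ₁ s)))) := by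
    linear_combination q' - q
  have t1 : |((γ₂ (lam s') - γ₂ (lam s)) - (γ₁ s' - γ₁ s)) * (φ₂ (lam s') + φ₁ s')| ≤
      (B * (lam s' - lam s) + B * (s' - s)) * (P + P) := by
    rw [abs_mul]
    exact mul_le_mul ((abs_sub _ _).trans (add_le_add g2 g1))
      ((abs_add_le _ _).trans (add_le_add c2 c1)) (abs_nonneg _) (by positivity)
  have t2 : |(γ₂ (lam s) - γ₁ s) * ((φ₂ (lam s') - φ₂ (lam s)) + (φ₁ s' - φ₁ s))| ≤
      (A + A) * (L * (lam s' - lam s) + L * (s' - s)) := by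
    rw [abs_mul]
    exact mul_le_mul ((abs_sub _ _).trans (add_le_add b2 b1))
      ((abs_add_le _ _).trans (add_le_add f2 f1)) (abs_nonneg _) (by positivity)
  have key : |(lam s' - lam s) - (s' - s)| ≤ 193 / 5000 * ((lam s' - lam s) + (s' - s)) := by
    rw [e, abs_neg, abs_mul, abs_of_pos (by norm_num : (0:ℝ) < 2)]
    have t3 := (abs_add_le _ _).trans (add_le_add t1 t2)
    have hs4 : 4 * (B * P + A * L) ≤ 193 / 5000 := by
      nlinarith [h.small, mul_nonneg hA hP, mul_nonneg hB hL]
    have := mul_le_mul_of_nonneg_right hs4 (add_pos hl hΔ).le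
    nlinarith
  have k := abs_le.1 key
  exact ⟨hl, by linarith [k.2], by linarith [k.1]⟩

theorem Ioo_Icc {s : ℝ} (hs : s ∈ Ioo 0 tb) : s ∈ Icc 0 tb := Ioo_subset_Icc_self hs

theorem zero_mem {s : ℝ} (hs : s ∈ Ioo 0 tb) : (0 : ℝ) ∈ Icc 0 tb :=
  ⟨le_rfl, (hs.1.trans hs.2).le⟩

theorem tb_mem {s : ℝ} (hs : s ∈ Ioo 0 tb) : tb ∈ Icc 0 tb :=
  ⟨(hs.1.trans hs.2).le, le_rfl⟩

theorem lam_Ioo (h : IsLens tb A B P L γ₁ γ₂ φ₁ φ₂ lam) {s : ℝ} (hs : s ∈ Ioo 0 tb) :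
    lam s ∈ Ioo 0 tb := by
  constructor
  · rw [← h.lam_zero]; exact h.lam_mono (zero_mem hs) (Ioo_Icc hs) hs.1
  · rw [← h.lam_tb]; exact h.lam_mono (Ioo_Icc hs) (tb_mem hs) hs.2

theorem width_pos (h : IsLens tb A B P L γ₁ γ₂ φ₁ φ₂ lam) {s : ℝ} (hs : s ∈ Ioo 0 tb) :
    0 < lensWidth γ₁ γ₂ lam s := by
  have := h.gam₁_neg s hs
  have := h.gam₂_pos _ (h.lam_Ioo hs)
  unfold lensWidth; linarith

theorem abs_phi_sub_le (h : IsLens tb A B P L γ₁ γ₂ φ₁ φ₂ lam) {s : ℝ} (hs : s ∈ Ioo 0 tb) :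
    |φ₂ (lam s) - φ₁ s| ≤ 2081 / 1000 * L * s ∧
    |φ₂ (lam s) - φ₁ s| ≤ 2081 / 1000 * L * (tb - s) ∧
    |φ₂ (lam s) - φ₁ s| ≤ 2081 / 1000 * L * lam s ∧
    |φ₂ (lam s) - φ₁ s| ≤ 2081 / 1000 * L * (tb - lam s) := by
  have hL := h.L_nonneg
  obtain ⟨-, a1, a2⟩ := h.lam_sub (zero_mem hs) (Ioo_Icc hs) hs.1
  obtain ⟨-, a3, a4⟩ := h.lam_sub (Ioo_Icc hs) (tb_mem hs) hs.2
  rw [h.lam_zero] at a1 a2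
  rw [h.lam_tb] at a3 a4
  have hl := h.lam_Ioo hs
  have p1 := h.lip_phi₁ s (Ioo_Icc hs) 0 (zero_mem hs)
  have p2 := h.lip_phi₂ _ (Ioo_Icc hl) 0 (zero_mem hs)
  have p3 := h.lip_phi₁ s (Ioo_Icc hs) tb (tb_mem hs)
  have p4 := h.lip_phi₂ _ (Ioo_Icc hl) tb (tb_mem hs)
  rw [zero_sub, abs_neg, abs_of_pos hs.1, h.phi_zero] at p1
  rw [zero_sub, abs_neg, abs_of_pos hl.1] at p2
  rw [abs_of_pos (sub_pos.2 hs.2), h.phi_tb] at p3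
  rw [abs_of_pos (sub_pos.2 hl.2)] at p4
  have b1 : |φ₂ (lam s) - φ₁ s| ≤ L * (s + lam s) := by
    rw [show φ₂ (lam s) - φ₁ s = (φ₂ 0 - φ₁ s) - (φ₂ 0 - φ₂ (lam s)) by ring, mul_add]
    exact (abs_sub _ _).trans (add_le_add p1 p2)
  have b2 : |φ₂ (lam s) - φ₁ s| ≤ L * ((tb - s) + (tb - lam s)) := by
    rw [show φ₂ (lam s) - φ₁ s = (φ₂ tb - φ₁ s) - (φ₂ tb - φ₂ (lam s)) by ring, mul_add]
    exact (abs_sub _ _).trans (add_le_add p3 p4)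
  refine ⟨b1.trans ?_, b2.trans ?_, b1.trans ?_, b2.trans ?_⟩ <;> nlinarith

/-- `s` and `s'` are close relative to the distance to the right endpoint. -/
def Close (tb : ℝ) (γ₁ γ₂ lam : ℝ → ℝ) (s s' : ℝ) : Prop :=
  lensWidth γ₁ γ₂ lam s' * (tb - s) ≤ 3 / 2 * (lensWidth γ₁ γ₂ lam s * (tb - s')) ∧
  lensWidth γ₁ γ₂ lam s' * (tb - lam s) ≤ 3 / 2 * (lensWidth γ₁ γ₂ lam s * (tb - lam s'))

theorem abs_slope_mul_le (h : IsLens tb A B P L γ₁ γ₂ φ₁ φ₂ lam) {s s' : ℝ} (hs : s ∈ Ioo 0 tb)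
    (hs' : s' ∈ Ioo 0 tb) (hss : s < s') (hcl : Close tb γ₁ γ₂ lam s s') :
    |lensSlope γ₁ γ₂ φ₁ φ₂ lam s * (γ₁ s' - γ₁ s)| ≤ 7 / 2 * L * (s' - s) ∧
    |lensSlope γ₁ γ₂ φ₁ φ₂ lam s * (γ₂ (lam s') - γ₂ (lam s))| ≤ 7 / 2 * L * (s' - s) := by
  have hL := h.L_nonneg
  have hb := h.width_pos hs
  have hl := h.lam_Ioo hs
  have hl' := h.lam_Ioo hs'
  obtain ⟨a1, a2, a3, a4⟩ := h.abs_phi_sub_le hs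
  obtain ⟨l0, l1, -⟩ := h.lam_sub (Ioo_Icc hs) (Ioo_Icc hs') hss
  have hΔ : 0 < s' - s := sub_pos.2 hss
  have c1 := h.convex.slope_mono_adjacent (zero_mem hs) (Ioo_Icc hs') hs.1 hss
  have c2 := h.convex.slope_mono_adjacent (Ioo_Icc hs) (tb_mem hs) hss hs'.2
  have d1 := h.concave.slope_anti_adjacent (zero_mem hs) (Ioo_Icc hl') hl.1 (sub_pos.1 l0)
  have d2 := h.concave.slope_anti_adjacent (Ioo_Icc hl) (tb_mem hs) (sub_pos.1 l0) hl'.2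
  rw [h.gam₁_zero, sub_zero, sub_zero, div_le_div_iff₀ hs.1 hΔ] at c1
  rw [h.gam₁_tb, div_le_div_iff₀ hΔ (sub_pos.2 hs'.2)] at c2
  rw [h.gam₂_zero, sub_zero, sub_zero, div_le_div_iff₀ l0 hl.1] at d1
  rw [h.gam₂_tb, div_le_div_iff₀ (sub_pos.2 hl'.2) l0] at d2
  have n1 := h.gam₁_neg s hs
  have n1' := h.gam₁_neg s' hs'
  have n2 := h.gam₂_pos _ hl
  have n2' := h.gam₂_pos _ hl'
  have w : lensWidth γ₁ γ₂ lam s = γ₂ (lam s) - γ₁ s := rfl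
  have w' : lensWidth γ₁ γ₂ lam s' = γ₂ (lam s') - γ₁ s' := rfl
  have e1 := abs_mul_abs_le_of_slopes (D := γ₁ s' - γ₁ s) (by positivity) hb (sub_pos.2 hs'.2) hΔ
    a1 a2 (by rw [w]; nlinarith) (b' := lensWidth γ₁ γ₂ lam s') (by rw [w']; nlinarith)
    (sub_pos.2 hs.2) hcl.1
  have e2 := abs_mul_abs_le_of_slopes (D := -(γ₂ (lam s') - γ₂ (lam s))) (by positivity) hb
    (sub_pos.2 hl'.2) l0 a3 a4 (by rw [w]; nlinarith) (b' := lensWidth γ₁ γ₂ lam s')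
    (by rw [w']; nlinarith) (sub_pos.2 hl.2) hcl.2
  rw [abs_neg] at e2
  have hLΔ : 0 ≤ L * (s' - s) := by positivity
  have hLl := mul_le_mul_of_nonneg_left l1 hL
  constructor
  · rw [lensSlope, abs_mul, abs_div, abs_of_pos hb, div_mul_eq_mul_div, div_le_iff₀ hb]
    refine e1.trans (mul_le_mul_of_nonneg_right ?_ hb.le)
    nlinarith
  · rw [lensSlope, abs_mul, abs_div, abs_of_pos hb, div_mul_eq_mul_div, div_le_iff₀ hb]
    refine e2.trans (mul_le_mul_of_nonneg_right ?_ hb.le)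
    nlinarith

theorem width_mul_abs_slope_sub_le (h : IsLens tb A B P L γ₁ γ₂ φ₁ φ₂ lam) {s s' : ℝ}
    (hs : s ∈ Ioo 0 tb) (hs' : s' ∈ Ioo 0 tb) (hss : s < s') (hcl : Close tb γ₁ γ₂ lam s s') :
    lensWidth γ₁ γ₂ lam s' *
      |lensSlope γ₁ γ₂ φ₁ φ₂ lam s' - lensSlope γ₁ γ₂ φ₁ φ₂ lam s| ≤ 91 / 10 * L * (s' - s) := by
  have hL := h.L_nonneg
  have hb := h.width_pos hs
  have hb' := h.width_pos hs'
  obtain ⟨e1, e2⟩ := h.abs_slope_mul_le hs hs' hss hcl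
  obtain ⟨l0, l1, -⟩ := h.lam_sub (Ioo_Icc hs) (Ioo_Icc hs') hss
  have hΔ : 0 < s' - s := sub_pos.2 hss
  have f1 := h.lip_phi₁ s (Ioo_Icc hs) s' (Ioo_Icc hs')
  have f2 := h.lip_phi₂ _ (Ioo_Icc (h.lam_Ioo hs)) _ (Ioo_Icc (h.lam_Ioo hs'))
  rw [abs_of_pos hΔ] at f1
  rw [abs_of_pos l0] at f2
  have m' : lensSlope γ₁ γ₂ φ₁ φ₂ lam s' * lensWidth γ₁ γ₂ lam s' = φ₂ (lam s') - φ₁ s' :=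
    div_mul_cancel₀ _ hb'.ne'
  have m : lensSlope γ₁ γ₂ φ₁ φ₂ lam s * lensWidth γ₁ γ₂ lam s = φ₂ (lam s) - φ₁ s :=
    div_mul_cancel₀ _ hb.ne'
  have e : lensWidth γ₁ γ₂ lam s' *
      (lensSlope γ₁ γ₂ φ₁ φ₂ lam s' - lensSlope γ₁ γ₂ φ₁ φ₂ lam s) =
      ((φ₂ (lam s') - φ₂ (lam s)) - (φ₁ s' - φ₁ s)) -
      (lensSlope γ₁ γ₂ φ₁ φ₂ lam s * (γ₂ (lam s') - γ₂ (lam s)) -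
        lensSlope γ₁ γ₂ φ₁ φ₂ lam s * (γ₁ s' - γ₁ s)) := by
    unfold lensWidth at *
    linear_combination m' - m
  rw [← abs_of_pos hb', ← abs_mul, e]
  have t := (abs_sub _ _).trans (add_le_add ((abs_sub _ _).trans (add_le_add f2 f1))
    ((abs_sub _ _).trans (add_le_add e2 e1)))
  have hLl := mul_le_mul_of_nonneg_left l1 hL
  have hLΔ : 0 ≤ L * (s' - s) := by positivity
  linarith

/-- `y` lies in the interior of the projected ruling at parameter `s`. -/
def Adm (tb : ℝ) (γ₁ γ₂ lam : ℝ → ℝ) (s y : ℝ) : Prop :=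
  s ∈ Ioo 0 tb ∧ γ₁ s < y ∧ y < γ₂ (lam s)

theorem local_mono (h : IsLens tb A B P L γ₁ γ₂ φ₁ φ₂ lam) {s s' y : ℝ}
    (hs : Adm tb γ₁ γ₂ lam s y) (hs' : Adm tb γ₁ γ₂ lam s' y) (hss : s < s')
    (hcl : Close tb γ₁ γ₂ lam s s') :
    lensHeight γ₁ γ₂ φ₁ φ₂ lam s y + 1 / 4 * (s' - s) ≤ lensHeight γ₁ γ₂ φ₁ φ₂ lam s' y ∧
    lensHeight γ₁ γ₂ φ₁ φ₂ lam s y - 4 * y * lensGraph γ₁ γ₂ φ₁ φ₂ lam s y ≤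
      lensHeight γ₁ γ₂ φ₁ φ₂ lam s' y - 4 * y * lensGraph γ₁ γ₂ φ₁ φ₂ lam s' y := by
  obtain ⟨hs, y1, y2⟩ := hs
  obtain ⟨hs', y1', y2'⟩ := hs'
  have hA := h.A_nonneg (Ioo_Icc hs)
  have hP := h.P_nonneg (Ioo_Icc hs)
  have hB := h.B_nonneg
  have hL := h.L_nonneg
  obtain ⟨e1, -⟩ := h.abs_slope_mul_le hs hs' hss hcl
  have e2 := h.width_mul_abs_slope_sub_le hs hs' hss hcl
  have hΔ : 0 < s' - s := sub_pos.2 hss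
  have f1 := h.lip_phi₁ s (Ioo_Icc hs) s' (Ioo_Icc hs')
  have g1 := h.lip_gam₁ s (Ioo_Icc hs) s' (Ioo_Icc hs')
  rw [abs_of_pos hΔ] at f1 g1
  have hw : y - γ₁ s' ≤ lensWidth γ₁ γ₂ lam s' := by unfold lensWidth; linarith
  have n1 := abs_le.1 (h.gam₁_le s (Ioo_Icc hs))
  have n1' := abs_le.1 (h.gam₁_le s' (Ioo_Icc hs'))
  have n2' := abs_le.1 (h.gam₂_le _ (Ioo_Icc (h.lam_Ioo hs')))
  have p1 := h.phi₁_le s (Ioo_Icc hs)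
  have p1' := h.phi₁_le s' (Ioo_Icc hs')
  have sm : 4 * (A * L + B * P) * (s' - s) ≤ 193 / 5000 * (s' - s) := by
    refine mul_le_mul_of_nonneg_right ?_ hΔ.le
    nlinarith [h.small, mul_nonneg hA hP, mul_nonneg hB hL]
  have nAL : 0 ≤ A * L * (s' - s) := by positivity
  have nBP : 0 ≤ B * P * (s' - s) := by positivity
  set m := lensSlope γ₁ γ₂ φ₁ φ₂ lam s
  set m' := lensSlope γ₁ γ₂ φ₁ φ₂ lam s'
  have hm : (y - γ₁ s') * |m' - m| ≤ 91 / 10 * L * (s' - s) :=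
    (mul_le_mul_of_nonneg_right hw (abs_nonneg _)).trans e2
  have hmul : ∀ {u v U V : ℝ}, |u| ≤ U → |v| ≤ V → |u * v| ≤ U * V := fun hu hv => by
    rw [abs_mul]
    exact mul_le_mul hu hv (abs_nonneg _) ((abs_nonneg _).trans hu)
  have hm2 : |(m' - m) * (y - γ₁ s')| ≤ 91 / 10 * L * (s' - s) := by
    rwa [abs_mul, mul_comm, abs_of_pos (sub_pos.2 y1')]
  constructor
  · have t1 := hmul (h.gam₁_le s' (Ioo_Icc hs')) f1
    have t2 := hmul p1 g1
    have t3 := hmul hm2 (show |y + γ₁ s'| ≤ 2 * A from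
      abs_le.2 ⟨by linarith, by linarith⟩)
    have t4 := hmul e1 (show |γ₁ s' + γ₁ s| ≤ 2 * A from
      abs_le.2 ⟨by linarith, by linarith⟩)
    have e : lensHeight γ₁ γ₂ φ₁ φ₂ lam s' y - lensHeight γ₁ γ₂ φ₁ φ₂ lam s y =
        (s' - s) + 4 * (γ₁ s' * (φ₁ s' - φ₁ s)) + 4 * (φ₁ s * (γ₁ s' - γ₁ s)) +
        2 * ((m' - m) * (y - γ₁ s') * (y + γ₁ s')) -
        2 * (m * (γ₁ s' - γ₁ s) * (γ₁ s' + γ₁ s)) := by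
      unfold lensHeight; ring
    linarith [(abs_le.1 t1).1, (abs_le.1 t2).1, (abs_le.1 t3).1, (abs_le.1 t4).2]
  · have t1 := hmul f1 (show |y - γ₁ s'| ≤ 2 * A from
      abs_le.2 ⟨by linarith, by linarith⟩)
    have t2 := hmul p1 g1
    have t3 := hmul hm2 (show |y - γ₁ s'| ≤ 2 * A from
      abs_le.2 ⟨by linarith, by linarith⟩)
    have t4 := hmul e1 (show |2 * y - γ₁ s' - γ₁ s| ≤ 4 * A from
      abs_le.2 ⟨by linarith, by linarith⟩)
    have e : (lensHeight γ₁ γ₂ φ₁ φ₂ lam s' y - 4 * y * lensGraph γ₁ γ₂ φ₁ φ₂ lam s' y) -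
        (lensHeight γ₁ γ₂ φ₁ φ₂ lam s y - 4 * y * lensGraph γ₁ γ₂ φ₁ φ₂ lam s y) =
        (s' - s) - 4 * ((φ₁ s' - φ₁ s) * (y - γ₁ s')) + 4 * (φ₁ s * (γ₁ s' - γ₁ s)) -
        2 * ((m' - m) * (y - γ₁ s') * (y - γ₁ s')) +
        2 * (m * (γ₁ s' - γ₁ s) * (2 * y - γ₁ s' - γ₁ s)) := by
      unfold lensHeight lensGraph; ring
    linarith [(abs_le.1 t1).2, (abs_le.1 t2).1, (abs_le.1 t3).2, (abs_le.1 t4).1]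

end IsLens

theorem le_of_forall_exists_local_le {N : ℝ → ℝ} {a b : ℝ} (hab : a ≤ b)
    (hN : ContinuousOn N (Icc a b))
    (hloc : ∀ x ∈ Ico a b, ∃ ε > 0, ∀ z ∈ Icc a b, x < z → z < x + ε → N x ≤ N z) : N a ≤ N b := by
  have key : Icc a b ⊆ {x | N a ≤ N x} := by
    refine IsClosed.Icc_subset_of_forall_exists_gt ?_ (le_refl (N a)) ?_
    · rw [inter_comm]
      exact hN.preimage_isClosed_of_isClosed isClosed_Icc isClosed_Ici
    · rintro x ⟨hx, hxab⟩ y hy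
      obtain ⟨ε, hε, h⟩ := hloc x hxab
      have hz : x < min (min b y) (x + ε / 2) :=
        lt_min (lt_min hxab.2 hy) (by linarith)
      have hzb := (min_le_left (min b y) (x + ε / 2)).trans (min_le_left _ _)
      have hzy := (min_le_left (min b y) (x + ε / 2)).trans (min_le_right _ _)
      have hze := min_le_right (min b y) (x + ε / 2)
      exact ⟨_, le_trans hx (h _ ⟨hxab.1.trans hz.le, hzb⟩ hz (by linarith)), hz, hzy⟩
  exact key (right_mem_Icc.2 hab)

theorem continuousAt_of_abs_sub_le {g : ℝ → ℝ} {C a b s : ℝ}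
    (hg : ∀ s ∈ Icc a b, ∀ s' ∈ Icc a b, |g s' - g s| ≤ C * |s' - s|) (hs : s ∈ Ioo a b) :
    ContinuousAt g s := by
  have : LipschitzOnWith C.toNNReal g (Icc a b) := LipschitzOnWith.of_dist_le_mul
    fun x hx y hy => (hg y hy x hx).trans (by
      rw [Real.dist_eq]
      gcongr
      exact Real.le_coe_toNNReal C)
  exact this.continuousOn.continuousAt (Icc_mem_nhds hs.1 hs.2)

namespace IsLens

variable {tb A B P L : ℝ} {γ₁ γ₂ φ₁ φ₂ lam : ℝ → ℝ}

theorem continuousAt_lam (h : IsLens tb A B P L γ₁ γ₂ φ₁ φ₂ lam) {s : ℝ} (hs : s ∈ Ioo 0 tb) :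
    ContinuousAt lam s := by
  refine continuousAt_of_abs_sub_le (C := 1081 / 1000) (fun x hx y hy => ?_) hs
  rcases lt_trichotomy x y with hxy | rfl | hxy
  · obtain ⟨l0, l1, -⟩ := h.lam_sub hx hy hxy
    rwa [abs_of_pos l0, abs_of_pos (sub_pos.2 hxy)]
  · simp
  · obtain ⟨l0, l1, -⟩ := h.lam_sub hy hx hxy
    rwa [abs_sub_comm, abs_of_pos l0, abs_sub_comm, abs_of_pos (sub_pos.2 hxy)]

theorem continuousAt_gam₁ (h : IsLens tb A B P L γ₁ γ₂ φ₁ φ₂ lam) {s : ℝ} (hs : s ∈ Ioo 0 tb) :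
    ContinuousAt γ₁ s := continuousAt_of_abs_sub_le h.lip_gam₁ hs

theorem continuousAt_phi₁ (h : IsLens tb A B P L γ₁ γ₂ φ₁ φ₂ lam) {s : ℝ} (hs : s ∈ Ioo 0 tb) :
    ContinuousAt φ₁ s := continuousAt_of_abs_sub_le h.lip_phi₁ hs

theorem continuousAt_gam₂_lam (h : IsLens tb A B P L γ₁ γ₂ φ₁ φ₂ lam) {s : ℝ}
    (hs : s ∈ Ioo 0 tb) : ContinuousAt (fun s => γ₂ (lam s)) s :=
  ContinuousAt.comp (continuousAt_of_abs_sub_le h.lip_gam₂ (h.lam_Ioo hs)) (h.continuousAt_lam hs)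

theorem continuousAt_phi₂_lam (h : IsLens tb A B P L γ₁ γ₂ φ₁ φ₂ lam) {s : ℝ}
    (hs : s ∈ Ioo 0 tb) : ContinuousAt (fun s => φ₂ (lam s)) s :=
  ContinuousAt.comp (continuousAt_of_abs_sub_le h.lip_phi₂ (h.lam_Ioo hs)) (h.continuousAt_lam hs)

theorem continuousAt_width (h : IsLens tb A B P L γ₁ γ₂ φ₁ φ₂ lam) {s : ℝ}
    (hs : s ∈ Ioo 0 tb) : ContinuousAt (lensWidth γ₁ γ₂ lam) s :=
  (h.continuousAt_gam₂_lam hs).sub (h.continuousAt_gam₁ hs)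

theorem continuousAt_slope (h : IsLens tb A B P L γ₁ γ₂ φ₁ φ₂ lam) {s : ℝ}
    (hs : s ∈ Ioo 0 tb) : ContinuousAt (lensSlope γ₁ γ₂ φ₁ φ₂ lam) s :=
  ((h.continuousAt_phi₂_lam hs).sub (h.continuousAt_phi₁ hs)).div (h.continuousAt_width hs)
    (h.width_pos hs).ne'

theorem continuousAt_height (h : IsLens tb A B P L γ₁ γ₂ φ₁ φ₂ lam) {s : ℝ}
    (hs : s ∈ Ioo 0 tb) (y : ℝ) : ContinuousAt (fun s => lensHeight γ₁ γ₂ φ₁ φ₂ lam s y) s := by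
  have h1 := h.continuousAt_gam₁ hs
  have h2 := h.continuousAt_phi₁ hs
  have h3 := h.continuousAt_slope hs
  unfold lensHeight
  fun_prop

theorem continuousAt_graph (h : IsLens tb A B P L γ₁ γ₂ φ₁ φ₂ lam) {s : ℝ}
    (hs : s ∈ Ioo 0 tb) (y : ℝ) : ContinuousAt (fun s => lensGraph γ₁ γ₂ φ₁ φ₂ lam s y) s := by
  have h1 := h.continuousAt_gam₁ hs
  have h2 := h.continuousAt_phi₁ hs
  have h3 := h.continuousAt_slope hs
  unfold lensGraph
  fun_prop

theorem exists_close (h : IsLens tb A B P L γ₁ γ₂ φ₁ φ₂ lam) {s₀ : ℝ} (hs₀ : s₀ ∈ Ioo 0 tb) :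
    ∃ ε > 0, ∀ s s', |s - s₀| < ε → |s' - s₀| < ε → s ∈ Ioo 0 tb ∧ s' ∈ Ioo 0 tb ∧
      lensWidth γ₁ γ₂ lam s₀ / 2 < lensWidth γ₁ γ₂ lam s' ∧ Close tb γ₁ γ₂ lam s s' := by
  have hb := h.width_pos hs₀
  have c1 : ContinuousAt (fun q : ℝ × ℝ => lensWidth γ₁ γ₂ lam q.1) (s₀, s₀) :=
    ContinuousAt.comp (f := Prod.fst) (x := (s₀, s₀)) (h.continuousAt_width hs₀) continuousAt_fst
  have c2 : ContinuousAt (fun q : ℝ × ℝ => lensWidth γ₁ γ₂ lam q.2) (s₀, s₀) :=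
    ContinuousAt.comp (f := Prod.snd) (x := (s₀, s₀)) (h.continuousAt_width hs₀) continuousAt_snd
  have l1 : ContinuousAt (fun q : ℝ × ℝ => lam q.1) (s₀, s₀) :=
    ContinuousAt.comp (f := Prod.fst) (x := (s₀, s₀)) (h.continuousAt_lam hs₀) continuousAt_fst
  have l2 : ContinuousAt (fun q : ℝ × ℝ => lam q.2) (s₀, s₀) :=
    ContinuousAt.comp (f := Prod.snd) (x := (s₀, s₀)) (h.continuousAt_lam hs₀) continuousAt_snd
  have e1 : ∀ᶠ q : ℝ × ℝ in nhds (s₀, s₀), lensWidth γ₁ γ₂ lam q.2 * (tb - q.1) <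
      3 / 2 * (lensWidth γ₁ γ₂ lam q.1 * (tb - q.2)) := by
    refine ContinuousAt.eventually_lt (by fun_prop) (by fun_prop) ?_
    have := mul_pos hb (sub_pos.2 hs₀.2)
    linarith
  have e2 : ∀ᶠ q : ℝ × ℝ in nhds (s₀, s₀), lensWidth γ₁ γ₂ lam q.2 * (tb - lam q.1) <
      3 / 2 * (lensWidth γ₁ γ₂ lam q.1 * (tb - lam q.2)) := by
    refine ContinuousAt.eventually_lt (c2.mul (continuousAt_const.sub l1))
      ((c1.mul (continuousAt_const.sub l2)).const_mul _) ?_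
    have := mul_pos hb (sub_pos.2 (h.lam_Ioo hs₀).2)
    linarith
  have e3 : ∀ᶠ q : ℝ × ℝ in nhds (s₀, s₀), lensWidth γ₁ γ₂ lam s₀ / 2 < lensWidth γ₁ γ₂ lam q.2 :=
    c2.eventually (lt_mem_nhds (by simp only; linarith))
  have e4 : ∀ᶠ q : ℝ × ℝ in nhds (s₀, s₀), q.1 ∈ Ioo 0 tb ∧ q.2 ∈ Ioo 0 tb :=
    (continuousAt_fst.eventually (Ioo_mem_nhds hs₀.1 hs₀.2)).and
      (continuousAt_snd.eventually (Ioo_mem_nhds hs₀.1 hs₀.2))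
  obtain ⟨ε, hε, hq⟩ := Metric.eventually_nhds_iff.1 (((e1.and e2).and e3).and e4)
  refine ⟨ε, hε, fun s s' hs hs' => ?_⟩
  obtain ⟨⟨⟨q1, q2⟩, q3⟩, q4, q5⟩ := @hq (s, s') (by
    rw [Prod.dist_eq, Real.dist_eq, Real.dist_eq]; exact max_lt hs hs')
  exact ⟨q4, q5, q3, q1.le, q2.le⟩

theorem adm_of_mem_Icc (h : IsLens tb A B P L γ₁ γ₂ φ₁ φ₂ lam) {s s' r y : ℝ}
    (hs : Adm tb γ₁ γ₂ lam s y) (hs' : Adm tb γ₁ γ₂ lam s' y) (hr : r ∈ Icc s s') :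
    Adm tb γ₁ γ₂ lam r y := by
  have hr0 : r ∈ Ioo 0 tb := ⟨hs.1.1.trans_le hr.1, hr.2.trans_lt hs'.1.2⟩
  have m := h.lam_mono.monotoneOn
  refine ⟨hr0, ?_, ?_⟩
  · exact (h.convex.le_max_of_mem_Icc (Ioo_Icc hs.1) (Ioo_Icc hs'.1) hr).trans_lt
      (max_lt hs.2.1 hs'.2.1)
  · exact (lt_min hs.2.2 hs'.2.2).trans_le <| h.concave.min_le_of_mem_Icc
      (Ioo_Icc (h.lam_Ioo hs.1)) (Ioo_Icc (h.lam_Ioo hs'.1))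
      ⟨m (Ioo_Icc hs.1) (Ioo_Icc hr0) hr.1, m (Ioo_Icc hr0) (Ioo_Icc hs'.1) hr.2⟩

theorem height_mono (h : IsLens tb A B P L γ₁ γ₂ φ₁ φ₂ lam) {s s' y : ℝ}
    (hs : Adm tb γ₁ γ₂ lam s y) (hs' : Adm tb γ₁ γ₂ lam s' y) (hss : s ≤ s') :
    lensHeight γ₁ γ₂ φ₁ φ₂ lam s y + 1 / 4 * (s' - s) ≤ lensHeight γ₁ γ₂ φ₁ φ₂ lam s' y ∧
    lensHeight γ₁ γ₂ φ₁ φ₂ lam s y - 4 * y * lensGraph γ₁ γ₂ φ₁ φ₂ lam s y ≤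
      lensHeight γ₁ γ₂ φ₁ φ₂ lam s' y - 4 * y * lensGraph γ₁ γ₂ φ₁ φ₂ lam s' y := by
  have hadm : ∀ r ∈ Icc s s', Adm tb γ₁ γ₂ lam r y := fun r hr => h.adm_of_mem_Icc hs hs' hr
  have hloc : ∀ x ∈ Ico s s', ∃ ε > 0, ∀ z ∈ Icc s s', x < z → z < x + ε →
      Close tb γ₁ γ₂ lam x z := by
    intro x hx
    obtain ⟨ε, hε, hc⟩ := h.exists_close (hadm x (Ico_subset_Icc_self hx)).1
    refine ⟨ε, hε, fun z _ hxz hze => (hc x z (by simpa using hε) ?_).2.2.2⟩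
    rw [abs_of_pos (sub_pos.2 hxz)]; linarith
  constructor
  · have := le_of_forall_exists_local_le
      (N := fun r => lensHeight γ₁ γ₂ φ₁ φ₂ lam r y - 1 / 4 * r) hss (fun r hr => ?_) fun x hx => ?_
    · linarith
    · exact ((h.continuousAt_height (hadm r hr).1 y).sub (by fun_prop)).continuousWithinAt
    · obtain ⟨ε, hε, hc⟩ := hloc x hx
      refine ⟨ε, hε, fun z hz hxz hze => ?_⟩
      have := (h.local_mono (hadm x (Ico_subset_Icc_self hx)) (hadm z hz) hxz (hc z hz hxz hze)).1
      linarith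
  · refine le_of_forall_exists_local_le (N := fun r => lensHeight γ₁ γ₂ φ₁ φ₂ lam r y -
      4 * y * lensGraph γ₁ γ₂ φ₁ φ₂ lam r y) hss (fun r hr => ?_) fun x hx => ?_
    · exact ((h.continuousAt_height (hadm r hr).1 y).sub
        ((h.continuousAt_graph (hadm r hr).1 y).const_mul _)).continuousWithinAt
    · obtain ⟨ε, hε, hc⟩ := hloc x hx
      refine ⟨ε, hε, fun z hz hxz hze => ?_⟩
      exact (h.local_mono (hadm x (Ico_subset_Icc_self hx)) (hadm z hz) hxz (hc z hz hxz hze)).2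

theorem abs_sub_le_height (h : IsLens tb A B P L γ₁ γ₂ φ₁ φ₂ lam) {s s' y : ℝ}
    (hs : Adm tb γ₁ γ₂ lam s y) (hs' : Adm tb γ₁ γ₂ lam s' y) :
    |s' - s| ≤ 4 * |lensHeight γ₁ γ₂ φ₁ φ₂ lam s' y - lensHeight γ₁ γ₂ φ₁ φ₂ lam s y| := by
  rcases le_total s s' with hle | hle
  · have := (h.height_mono hs hs' hle).1
    rw [abs_of_nonneg (sub_nonneg.2 hle)]
    linarith [le_abs_self
      (lensHeight γ₁ γ₂ φ₁ φ₂ lam s' y - lensHeight γ₁ γ₂ φ₁ φ₂ lam s y)]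
  · have := (h.height_mono hs' hs hle).1
    rw [abs_of_nonpos (sub_nonpos.2 hle)]
    linarith [neg_abs_le
      (lensHeight γ₁ γ₂ φ₁ φ₂ lam s' y - lensHeight γ₁ γ₂ φ₁ φ₂ lam s y)]

theorem locallyLipschitzOn_slope (h : IsLens tb A B P L γ₁ γ₂ φ₁ φ₂ lam) :
    LocallyLipschitzOn (Ioo 0 tb) (lensSlope γ₁ γ₂ φ₁ φ₂ lam) := by
  intro s₀ hs₀
  obtain ⟨ε, hε, hc⟩ := h.exists_close hs₀
  have hb := h.width_pos hs₀
  have hL := h.L_nonneg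
  have key : ∀ s s', |s - s₀| < ε → |s' - s₀| < ε → s < s' →
      |lensSlope γ₁ γ₂ φ₁ φ₂ lam s' - lensSlope γ₁ γ₂ φ₁ φ₂ lam s| ≤
        (91 / 5 * L / lensWidth γ₁ γ₂ lam s₀) * (s' - s) := by
    intro s s' hs hs' hss
    obtain ⟨q1, q2, q3, q4⟩ := hc s s' hs hs'
    have := h.width_mul_abs_slope_sub_le q1 q2 hss q4
    rw [div_mul_eq_mul_div, le_div_iff₀ hb]
    have := mul_le_mul_of_nonneg_right q3.le
      (abs_nonneg (lensSlope γ₁ γ₂ φ₁ φ₂ lam s' - lensSlope γ₁ γ₂ φ₁ φ₂ lam s))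
    linarith
  refine ⟨(91 / 5 * L / lensWidth γ₁ γ₂ lam s₀).toNNReal, Metric.ball s₀ ε,
    mem_nhdsWithin_of_mem_nhds (Metric.ball_mem_nhds _ hε),
    LipschitzOnWith.of_dist_le_mul fun x hx y hy => ?_⟩
  rw [Metric.mem_ball, Real.dist_eq] at hx hy
  rw [Real.dist_eq, Real.dist_eq, Real.coe_toNNReal _ (by positivity)]
  rcases lt_trichotomy x y with hxy | rfl | hxy
  · rw [abs_sub_comm, abs_sub_comm x, abs_of_pos (sub_pos.2 hxy)]
    exact key x y hx hy hxy
  · simp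
  · rw [abs_of_pos (sub_pos.2 hxy)]
    exact key y x hy hx hxy

theorem eventually_adm (h : IsLens tb A B P L γ₁ γ₂ φ₁ φ₂ lam) {s₀ y₀ : ℝ}
    (h₀ : Adm tb γ₁ γ₂ lam s₀ y₀) :
    ∀ᶠ q : ℝ × ℝ in nhds (s₀, y₀), Adm tb γ₁ γ₂ lam q.1 q.2 := by
  obtain ⟨hs, h1, h2⟩ := h₀
  have c1 : ContinuousAt (fun q : ℝ × ℝ => γ₁ q.1) (s₀, y₀) :=
    ContinuousAt.comp (f := Prod.fst) (x := (s₀, y₀)) (h.continuousAt_gam₁ hs) continuousAt_fst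
  have c2 : ContinuousAt (fun q : ℝ × ℝ => γ₂ (lam q.1)) (s₀, y₀) :=
    ContinuousAt.comp (f := Prod.fst) (x := (s₀, y₀)) (h.continuousAt_gam₂_lam hs) continuousAt_fst
  exact (continuousAt_fst.eventually (Ioo_mem_nhds hs.1 hs.2)).and
    ((c1.eventually_lt continuousAt_snd h1).and (ContinuousAt.eventually_lt continuousAt_snd c2 h2))

theorem exists_adm_rect (h : IsLens tb A B P L γ₁ γ₂ φ₁ φ₂ lam) {s₀ y₀ : ℝ}
    (h₀ : Adm tb γ₁ γ₂ lam s₀ y₀) :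
    ∃ ε > 0, ∀ s y, |s - s₀| ≤ ε → |y - y₀| ≤ ε → Adm tb γ₁ γ₂ lam s y := by
  obtain ⟨ε, hε, hq⟩ := Metric.eventually_nhds_iff.1 (h.eventually_adm h₀)
  refine ⟨ε / 2, half_pos hε, fun s y hs hy => @hq (s, y) ?_⟩
  rw [Prod.dist_eq, Real.dist_eq, Real.dist_eq]
  exact max_lt (by simp only; linarith) (by simp only; linarith)

end IsLens

theorem LocallyLipschitzOn.comp_mapsTo {α β δ : Type*} [PseudoEMetricSpace α]
    [PseudoEMetricSpace β] [PseudoEMetricSpace δ] {f : α → β} {g : β → δ} {s : Set α} {t : Set β}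
    (hg : LocallyLipschitzOn t g) (hf : LocallyLipschitzOn s f) (hst : MapsTo f s t) :
    LocallyLipschitzOn s (g ∘ f) := by
  intro x hx
  obtain ⟨Kf, u, hu, hfu⟩ := hf hx
  obtain ⟨Kg, v, hv, hgv⟩ := hg (hst hx)
  have hpre : f ⁻¹' v ∈ nhdsWithin x s :=
    ((hf.continuousOn x hx).tendsto_nhdsWithin hst) hv
  exact ⟨Kg * Kf, u ∩ f ⁻¹' v, Filter.inter_mem hu hpre,
    hgv.comp (hfu.mono inter_subset_left) fun y hy => hy.2⟩

theorem LocallyLipschitzOn.fst_sub {g : ℝ × ℝ × ℝ → ℝ} {s : Set (ℝ × ℝ × ℝ)}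
    (hg : LocallyLipschitzOn s g) : LocallyLipschitzOn s fun p => p.1 - g p := by
  intro x hx
  obtain ⟨K, u, hu, h⟩ := hg hx
  exact ⟨1 + K, u, hu, (LipschitzWith.prod_fst.lipschitzOnWith (s := u)).sub h⟩

/-- Minimality of the subgraph of a function ruled by the curves `s = const`, where `σ` selects the
parameter of the ruling through a point. -/
theorem IsLens.PerH_le {tb A B P L : ℝ} {γ₁ γ₂ φ₁ φ₂ lam : ℝ → ℝ}
    (h : IsLens tb A B P L γ₁ γ₂ φ₁ φ₂ lam) {Dr : Set (ℝ × ℝ)} {σ ur : ℝ × ℝ → ℝ}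
    (hσ : ∀ w ∈ Dr, IsLens.Adm tb γ₁ γ₂ lam (σ w) w.1 ∧
      w.2 = lensHeight γ₁ γ₂ φ₁ φ₂ lam (σ w) w.1 ∧ ur w = lensGraph γ₁ γ₂ φ₁ φ₂ lam (σ w) w.1)
    (hD : ∀ s y, IsLens.Adm tb γ₁ γ₂ lam s y → (y, lensHeight γ₁ γ₂ φ₁ φ₂ lam s y) ∈ Dr)
    (hur : LocallyLipschitzOn Dr ur) {F K : Set (ℝ × ℝ × ℝ)} (hF : MeasurableSet F)
    (hK : IsCompact K)
    (hEK : ({p | piR p ∈ Dr ∧ ur (piR p) < p.1} \ F) ∪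
      (F \ {p | piR p ∈ Dr ∧ ur (piR p) < p.1}) ⊆ K) (hKD : K ⊆ {q | piR q ∈ Dr}) :
    PerH {p | piR p ∈ Dr ∧ ur (piR p) < p.1} {q | piR q ∈ Dr} ≤ PerH F {q | piR q ∈ Dr} := by
  have huniq : ∀ s y, IsLens.Adm tb γ₁ γ₂ lam s y →
      σ (y, lensHeight γ₁ γ₂ φ₁ φ₂ lam s y) = s := by
    intro s y hs
    obtain ⟨h1, h2, -⟩ := hσ _ (hD s y hs)
    have := h.abs_sub_le_height (φ₁ := φ₁) (φ₂ := φ₂) h1 hs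
    simp only at h2
    rw [← h2] at this
    simp only [sub_self, abs_zero, mul_zero] at this
    have := abs_eq_zero.1 (le_antisymm this (abs_nonneg _))
    linarith
  have hnear : ∀ w₀ ∈ Dr, ∀ η > 0, ∀ᶠ w in nhds w₀, w ∈ Dr ∧ |σ w - σ w₀| ≤ η := by
    intro w₀ hw₀ η hη
    obtain ⟨h1, h2, -⟩ := hσ w₀ hw₀
    obtain ⟨ε, hε, hrect⟩ := h.exists_adm_rect h1
    obtain ⟨δ, hδ, hδε, hδη⟩ : ∃ δ > 0, δ ≤ ε ∧ δ ≤ η :=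
      ⟨min ε η, lt_min hε hη, min_le_left _ _, min_le_right _ _⟩
    have a1 : IsLens.Adm tb γ₁ γ₂ lam (σ w₀ - δ) w₀.1 :=
      hrect _ _ (by rw [sub_sub_cancel_left, abs_neg, abs_of_pos hδ]; exact hδε)
        (by simpa using hε.le)
    have a2 : IsLens.Adm tb γ₁ γ₂ lam (σ w₀ + δ) w₀.1 :=
      hrect _ _ (by rw [add_sub_cancel_left, abs_of_pos hδ]; exact hδε) (by simpa using hε.le)
    have b1 := (h.height_mono (φ₁ := φ₁) (φ₂ := φ₂) a1 h1 (by linarith)).1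
    have b2 := (h.height_mono (φ₁ := φ₁) (φ₂ := φ₂) h1 a2 (by linarith)).1
    rw [← h2] at b1 b2
    have c : ∀ s, Continuous fun w : ℝ × ℝ => lensHeight γ₁ γ₂ φ₁ φ₂ lam s w.1 := fun s => by
      unfold lensHeight; fun_prop
    have e1 : ∀ᶠ w : ℝ × ℝ in nhds w₀, lensHeight γ₁ γ₂ φ₁ φ₂ lam (σ w₀ - δ) w.1 < w.2 :=
      (c _).continuousAt.eventually_lt continuousAt_snd (by linarith)
    have e2 : ∀ᶠ w : ℝ × ℝ in nhds w₀, w.2 < lensHeight γ₁ γ₂ φ₁ φ₂ lam (σ w₀ + δ) w.1 :=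
      ContinuousAt.eventually_lt continuousAt_snd (c _).continuousAt (by linarith)
    have e3 : ∀ᶠ w : ℝ × ℝ in nhds w₀, |w.1 - w₀.1| < ε :=
      ContinuousAt.eventually_lt (by fun_prop) continuousAt_const (by simpa using hε)
    filter_upwards [e1, e2, e3] with w w1 w2 w3
    have hadm : ∀ s ∈ Icc (σ w₀ - δ) (σ w₀ + δ), IsLens.Adm tb γ₁ γ₂ lam s w.1 := fun s hs =>
      hrect _ _ (abs_le.2 ⟨by linarith [hs.1], by linarith [hs.2]⟩) w3.le
    obtain ⟨s, hs, hsT⟩ := intermediate_value_Icc (by linarith : σ w₀ - δ ≤ σ w₀ + δ)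
      (f := fun s => lensHeight γ₁ γ₂ φ₁ φ₂ lam s w.1)
      (fun s hs => (h.continuousAt_height (hadm s hs).1 _).continuousWithinAt) ⟨w1.le, w2.le⟩
    have hw : (w.1, lensHeight γ₁ γ₂ φ₁ φ₂ lam s w.1) = w := Prod.ext rfl hsT
    have hu := huniq s w.1 (hadm s hs)
    have hd := hD s w.1 (hadm s hs)
    rw [hw] at hu hd
    exact ⟨hd, by rw [hu]; exact abs_le.2 ⟨by linarith [hs.1], by linarith [hs.2]⟩⟩
  have hDo : IsOpen Dr := isOpen_iff_mem_nhds.2 fun w hw =>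
    Filter.mem_of_superset (hnear w hw 1 one_pos) fun _ hx => hx.1
  have hσlip : LocallyLipschitzOn Dr σ := by
    intro w₀ hw₀
    obtain ⟨h1, h2, -⟩ := hσ w₀ hw₀
    obtain ⟨ε, hε, hrect⟩ := h.exists_adm_rect h1
    have hm : ∀ᶠ s in nhds (σ w₀), |lensSlope γ₁ γ₂ φ₁ φ₂ lam s| <
        |lensSlope γ₁ γ₂ φ₁ φ₂ lam (σ w₀)| + 1 :=
      (h.continuousAt_slope h1.1).abs.eventually_lt continuousAt_const (lt_add_one _)
    obtain ⟨ε', hε', hm⟩ := Metric.eventually_nhds_iff.1 hm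
    obtain ⟨η, hη, hηε, hηε'⟩ : ∃ η > 0, η ≤ ε ∧ η < ε' :=
      ⟨min ε (ε' / 2), lt_min hε (half_pos hε'), min_le_left _ _,
        (min_le_right _ _).trans_lt (half_lt_self hε')⟩
    have e3 : ∀ᶠ w : ℝ × ℝ in nhds w₀, |w.1 - w₀.1| < ε :=
      ContinuousAt.eventually_lt (by fun_prop) continuousAt_const (by simpa using hε)
    set m₀ := |lensSlope γ₁ γ₂ φ₁ φ₂ lam (σ w₀)| + 1 with hm₀
    have hm₀' : 0 < m₀ := by positivity
    have hC : 0 ≤ 4 * (2 * m₀ * (2 * (|w₀.1| + ε)) + 1) := by positivity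
    refine ⟨⟨_, hC⟩, _, mem_nhdsWithin_of_mem_nhds ((hnear w₀ hw₀ η hη).and e3),
      LipschitzOnWith.of_dist_le_mul ?_⟩
    rintro w ⟨⟨hw, hwσ⟩, hwy⟩ w' ⟨⟨hw', hwσ'⟩, hwy'⟩
    have d1 : |w.1 - w'.1| ≤ dist w w' := le_max_left _ _
    have d2 : |w.2 - w'.2| ≤ dist w w' := le_max_right _ _
    have t1 := h.abs_sub_le_height (φ₁ := φ₁) (φ₂ := φ₂)
      (hrect _ _ (hwσ'.trans hηε) hwy'.le) (hrect _ _ (hwσ.trans hηε) hwy'.le)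
    rw [← (hσ w' hw').2.1] at t1
    have t2 : lensHeight γ₁ γ₂ φ₁ φ₂ lam (σ w) w'.1 - w'.2 =
        (w.2 - w'.2) - 2 * lensSlope γ₁ γ₂ φ₁ φ₂ lam (σ w) * (w.1 + w'.1) * (w.1 - w'.1) := by
      have := (hσ w hw).2.1
      unfold lensHeight at this ⊢
      linear_combination -this
    have t3 : |lensSlope γ₁ γ₂ φ₁ φ₂ lam (σ w)| ≤ m₀ :=
      (hm (by rw [Real.dist_eq]; exact hwσ.trans_lt hηε')).le
    have y1 : |w.1| ≤ |w₀.1| + ε := by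
      have := abs_sub_abs_le_abs_sub w.1 w₀.1
      linarith
    have y2 : |w'.1| ≤ |w₀.1| + ε := by
      have := abs_sub_abs_le_abs_sub w'.1 w₀.1
      linarith
    have t4 : |2 * lensSlope γ₁ γ₂ φ₁ φ₂ lam (σ w) * (w.1 + w'.1) * (w.1 - w'.1)| ≤
        2 * m₀ * (2 * (|w₀.1| + ε)) * dist w w' := by
      rw [abs_mul, abs_mul, abs_mul, abs_of_pos (zero_lt_two' ℝ)]
      gcongr
      exact (abs_add_le _ _).trans (by linarith)
    rw [t2] at t1
    have t5 := abs_sub (w.2 - w'.2)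
      (2 * lensSlope γ₁ γ₂ φ₁ φ₂ lam (σ w) * (w.1 + w'.1) * (w.1 - w'.1))
    rw [Real.dist_eq]
    change _ ≤ 4 * (2 * m₀ * (2 * (|w₀.1| + ε)) + 1) * dist w w'
    linarith
  have hpi : ContDiff ℝ 1 piR := by
    unfold piR; fun_prop
  have hΩ : IsOpen {q : ℝ × ℝ × ℝ | piR q ∈ Dr} := hDo.preimage hpi.continuous
  have hpiΩ : LocallyLipschitzOn {q : ℝ × ℝ × ℝ | piR q ∈ Dr} piR :=
    hpi.locallyLipschitz.locallyLipschitzOn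
  have hEeq : {p : ℝ × ℝ × ℝ | piR p ∈ Dr ∧ ur (piR p) < p.1} =
      {p | p ∈ {q : ℝ × ℝ × ℝ | piR q ∈ Dr} ∧ 0 < p.1 - ur (piR p)} := by
    ext p
    simp only [mem_ofPred_eq, sub_pos]
  rw [hEeq] at hEK ⊢
  have hline : ∀ (p w : ℝ × ℝ × ℝ) (S : Set (ℝ × ℝ)), S ∈ nhds (piR p) →
      ∀ᶠ r : ℝ in nhds 0, piR (p + r • w) ∈ S := by
    intro p w S hS
    have : Continuous fun r : ℝ => piR (p + r • w) := hpi.continuous.comp (by fun_prop)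
    have := this.tendsto 0
    simp only [zero_smul, add_zero] at this
    exact this hS
  refine PerH_le_of_calibration (f := fun p => p.1 - ur (piR p))
    (M := fun p => lensSlope γ₁ γ₂ φ₁ φ₂ lam (σ (piR p))) hΩ
    (hur.comp_mapsTo hpiΩ fun _ hp => hp).fst_sub
    ((h.locallyLipschitzOn_slope.comp_mapsTo hσlip fun w hw => (hσ w hw).1.1).comp_mapsTo hpiΩ
      fun _ hp => hp) (fun p hp => ?_) (fun p hp => ?_) hF hK hEK hKD
  · obtain ⟨h1, h2, h3⟩ := hσ _ hp
    obtain ⟨ε, hε, hrect⟩ := h.exists_adm_rect h1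
    filter_upwards [Metric.ball_mem_nhds (0 : ℝ) hε] with r hr
    rw [Metric.mem_ball, dist_zero_right, Real.norm_eq_abs] at hr
    set s := σ (piR p) with hs
    set m := lensSlope γ₁ γ₂ φ₁ φ₂ lam s with hm
    have hadm : IsLens.Adm tb γ₁ γ₂ lam s (p.2.1 + r) :=
      hrect _ _ (by simpa using hε.le) (by simpa [piR] using hr.le)
    have e : piR (p + r • (m, 1, 2 * (p.2.1 * m - p.1))) =
        (p.2.1 + r, lensHeight γ₁ γ₂ φ₁ φ₂ lam s (p.2.1 + r)) := by
      refine Prod.ext (by simp [piR]) ?_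
      simp only [piR, lensHeight, Prod.fst_add, Prod.snd_add, Prod.smul_fst, Prod.smul_snd,
        smul_eq_mul] at h2 ⊢
      rw [← hm] at h2 ⊢
      linear_combination h2
    have hu := huniq s _ hadm
    refine ⟨?_, by rw [e, hu]⟩
    have h3' := (hσ _ (hD s _ hadm)).2.2
    rw [hu] at h3'
    rw [e, h3', h3]
    simp only [piR, lensGraph, Prod.fst_add, Prod.smul_fst, smul_eq_mul]
    rw [← hm]
    ring
  · obtain ⟨h1, h2, h3⟩ := hσ _ hp
    filter_upwards [nhdsWithin_le_nhds (hline p (1, 0, 2 * p.2.1) Dr (hDo.mem_nhds hp)),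
      self_mem_nhdsWithin] with r hr hr0
    rw [mem_Ioi] at hr0
    obtain ⟨h1', h2', h3'⟩ := hσ _ hr
    have e : piR (p + r • (1, 0, 2 * p.2.1)) = (p.2.1, (piR p).2 + 4 * r * p.2.1) := by
      refine Prod.ext (by simp [piR]) ?_
      simp only [piR, Prod.fst_add, Prod.snd_add, Prod.smul_fst, Prod.smul_snd, smul_eq_mul]
      ring
    set w' := piR (p + r • (1, 0, 2 * p.2.1)) with hw'
    have e1 : w'.1 = p.2.1 := by rw [e]
    have e2 : w'.2 = (piR p).2 + 4 * r * p.2.1 := by rw [e]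
    have e0 : (piR p).1 = p.2.1 := rfl
    rw [e1] at h1' h2' h3'
    rw [e0] at h1 h2 h3
    rw [e2] at h2'
    suffices ur w' - ur (piR p) ≤ r by
      simp only [Prod.fst_add, Prod.smul_fst, smul_eq_mul, mul_one]
      linarith
    rcases lt_trichotomy p.2.1 0 with hy | hy | hy
    · have hyr : r * p.2.1 < 0 := mul_neg_of_pos_of_neg hr0 hy
      have hss : σ w' ≤ σ (piR p) := by
        by_contra! hlt
        have := (h.height_mono (φ₁ := φ₁) (φ₂ := φ₂) h1 h1' hlt.le).1
        linarith
      have := (h.height_mono (φ₁ := φ₁) (φ₂ := φ₂) h1' h1 hss).2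
      rw [← h3, ← h3', ← h2, ← h2'] at this
      nlinarith
    · have : w' = piR p := by
        rw [e, hy, mul_zero, add_zero, ← hy]
        rfl
      rw [this, sub_self]
      exact hr0.le
    · have hyr : 0 < r * p.2.1 := mul_pos hr0 hy
      have hss : σ (piR p) ≤ σ w' := by
        by_contra! hlt
        have := (h.height_mono (φ₁ := φ₁) (φ₂ := φ₂) h1' h1 hlt.le).1
        linarith
      have := (h.height_mono (φ₁ := φ₁) (φ₂ := φ₂) h1 h1' hss).2
      rw [← h3, ← h3', ← h2, ← h2'] at this
      nlinarith

theorem IsLens.heisRho_eq {tb A B P L : ℝ} {γ₁ γ₂ φ₁ φ₂ lam : ℝ → ℝ}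
    (h : IsLens tb A B P L γ₁ γ₂ φ₁ φ₂ lam) {r s y : ℝ} (hs : s ∈ Ioo 0 tb)
    (hy : y = γ₁ s + r * lensWidth γ₁ γ₂ lam s) :
    (heisRho γ₁ γ₂ φ₁ φ₂ lam (r, s)).1 = lensGraph γ₁ γ₂ φ₁ φ₂ lam s y ∧
      piR (heisRho γ₁ γ₂ φ₁ φ₂ lam (r, s)) = (y, lensHeight γ₁ γ₂ φ₁ φ₂ lam s y) := by
  have hm : lensSlope γ₁ γ₂ φ₁ φ₂ lam s * lensWidth γ₁ γ₂ lam s = φ₂ (lam s) - φ₁ s :=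
    div_mul_cancel₀ _ (h.width_pos hs).ne'
  have hl := h.lam_sol s (Ioo_subset_Icc_self hs)
  have hb : lensWidth γ₁ γ₂ lam s = γ₂ (lam s) - γ₁ s := rfl
  simp only [heisRho, heisP, piR, lensGraph, lensHeight, Qphi, Prod.fst_add, Prod.snd_add,
    Prod.smul_fst, Prod.smul_snd, smul_eq_mul, Prod.mk.injEq] at hl ⊢
  subst hy
  refine ⟨?_, ?_, ?_⟩
  · linear_combination -r * hm
  · linear_combination -r * hb
  · rw [hb] at hm ⊢
    linear_combination
      r * hl - (4 * r * γ₁ s + 2 * r ^ 2 * (γ₂ (lam s) - γ₁ s)) * hm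

theorem IsLens.exists_heisRho_param {tb A B P L : ℝ} {γ₁ γ₂ φ₁ φ₂ lam : ℝ → ℝ}
    (h : IsLens tb A B P L γ₁ γ₂ φ₁ φ₂ lam) {s y : ℝ} (hs : IsLens.Adm tb γ₁ γ₂ lam s y) :
    ∃ r ∈ Ioo (0 : ℝ) 1, y = γ₁ s + r * lensWidth γ₁ γ₂ lam s := by
  have hb := h.width_pos hs.1
  refine ⟨(y - γ₁ s) / lensWidth γ₁ γ₂ lam s, ⟨div_pos (sub_pos.2 hs.2.1) hb, ?_⟩, ?_⟩
  · rw [div_lt_one hb, lensWidth]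
    linarith [hs.2.2]
  · rw [div_mul_cancel₀ _ hb.ne']
    ring

theorem IsLens.adm_of_param {tb A B P L : ℝ} {γ₁ γ₂ φ₁ φ₂ lam : ℝ → ℝ}
    (h : IsLens tb A B P L γ₁ γ₂ φ₁ φ₂ lam) {r s : ℝ} (hr : r ∈ Ioo (0 : ℝ) 1)
    (hs : s ∈ Ioo 0 tb) :
    IsLens.Adm tb γ₁ γ₂ lam s (γ₁ s + r * lensWidth γ₁ γ₂ lam s) := by
  have hb := h.width_pos hs
  refine ⟨hs, by linarith [mul_pos hr.1 hb], ?_⟩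
  have : γ₂ (lam s) = γ₁ s + lensWidth γ₁ γ₂ lam s := by rw [lensWidth]; ring
  rw [this]
  nlinarith [hr.2]

theorem LipschitzOnWith.abs_sub_le {f : ℝ → ℝ} {K : NNReal} {S : Set ℝ}
    (hf : LipschitzOnWith K f S) : ∀ s ∈ S, ∀ s' ∈ S, |f s' - f s| ≤ K * |s' - s| :=
  fun s hs s' hs' => by simpa [Real.dist_eq] using hf.dist_le_mul s' hs' s hs

/-- the right intrinsic epigraph `E^r_{u^r}` minimizes the horizontal
perimeter in the right cylinder `V·D^r` among compact perturbations. -/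
theorem stmt_16 (tb : ℝ) (htb : 0 < tb)
    (γ₁ γ₂ φ₁ φ₂ : ℝ → ℝ) (Mγ Lγ Mφ Lφ : NNReal)
    (hγ₁lip : LipschitzOnWith Lγ γ₁ (Set.Icc 0 tb))
    (hγ₂lip : LipschitzOnWith Lγ γ₂ (Set.Icc 0 tb))
    (hγ₁bd : ∀ s ∈ Set.Icc 0 tb, |γ₁ s| ≤ (Mγ : ℝ))
    (hγ₂bd : ∀ s ∈ Set.Icc 0 tb, |γ₂ s| ≤ (Mγ : ℝ))
    (hφ₁lip : LipschitzOnWith Lφ φ₁ (Set.Icc 0 tb))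
    (hφ₂lip : LipschitzOnWith Lφ φ₂ (Set.Icc 0 tb))
    (hφ₁bd : ∀ s ∈ Set.Icc 0 tb, |φ₁ s| ≤ (Mφ : ℝ))
    (hφ₂bd : ∀ s ∈ Set.Icc 0 tb, |φ₂ s| ≤ (Mφ : ℝ))
    (hsign : ∀ t ∈ Set.Ioo 0 tb, γ₁ t < 0 ∧ 0 < γ₂ t)
    (hγ₁0 : γ₁ 0 = 0) (hγ₁t : γ₁ tb = 0) (hγ₂0 : γ₂ 0 = 0) (hγ₂t : γ₂ tb = 0)
    (hφ0 : φ₁ 0 = φ₂ 0) (hφt : φ₁ tb = φ₂ tb)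
    (hconv : ConvexOn ℝ (Set.Icc 0 tb) γ₁)
    (hconc : ConcaveOn ℝ (Set.Icc 0 tb) γ₂)
    (zeta : ℝ) (hzdef : zeta = 4 * ((Mγ : ℝ) + (Lγ : ℝ)) * ((Mφ : ℝ) + (Lφ : ℝ)))
    (hzeta : zeta < (Real.sqrt 721 - 25) / 48)
    (lam : ℝ → ℝ)
    (hlam_bij : Set.BijOn lam (Set.Icc 0 tb) (Set.Icc 0 tb))
    (hlam_mono : StrictMonoOn lam (Set.Icc 0 tb))
    (hlam_sol : ∀ s ∈ Set.Icc 0 tb, Qphi γ₁ γ₂ φ₁ φ₂ s (lam s) = 0)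
    (hlam0 : lam 0 = 0) (hlamt : lam tb = tb)
    -- D^r and the right graph function u^r
    (Dr : Set (ℝ × ℝ)) (ur : ℝ × ℝ → ℝ)
    (hDr : Dr = piR '' (heisRho γ₁ γ₂ φ₁ φ₂ lam '' (Set.Ioo (0:ℝ) 1 ×ˢ Set.Ioo (0:ℝ) tb)))
    (hur_lip : ∀ w ∈ Dr, ∃ ε > (0:ℝ), ∃ K : NNReal,
      LipschitzOnWith K ur (Metric.ball w ε ∩ Dr))
    (hur_graph : heisRho γ₁ γ₂ φ₁ φ₂ lam '' (Set.Ioo (0:ℝ) 1 ×ˢ Set.Ioo (0:ℝ) tb)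
      = (fun w : ℝ × ℝ => (ur w, w.1, w.2 - 2 * w.1 * ur w)) '' Dr) :
    ∀ F : Set (ℝ × ℝ × ℝ), MeasurableSet F →
      (∃ K : Set (ℝ × ℝ × ℝ), IsCompact K ∧
        (({p | piR p ∈ Dr ∧ ur (piR p) < p.1} \ F) ∪
         (F \ {p | piR p ∈ Dr ∧ ur (piR p) < p.1})) ⊆ K ∧
        K ⊆ {q : ℝ × ℝ × ℝ | piR q ∈ Dr}) →
      PerH {p | piR p ∈ Dr ∧ ur (piR p) < p.1} {q : ℝ × ℝ × ℝ | piR q ∈ Dr}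
        ≤ PerH F {q : ℝ × ℝ × ℝ | piR q ∈ Dr} := by
  intro F hF ⟨K, hK, hEK, hKD⟩
  have hsqrt : Real.sqrt 721 ≤ 26.852 := Real.sqrt_le_iff.2 ⟨by norm_num, by norm_num⟩
  have h : IsLens tb Mγ Lγ Mφ Lφ γ₁ γ₂ φ₁ φ₂ lam :=
    { B_nonneg := Lγ.2
      L_nonneg := Lφ.2
      small := by rw [← hzdef]; linarith
      lip_gam₁ := hγ₁lip.abs_sub_le
      lip_gam₂ := hγ₂lip.abs_sub_le
      lip_phi₁ := hφ₁lip.abs_sub_le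
      lip_phi₂ := hφ₂lip.abs_sub_le
      gam₁_le := hγ₁bd
      gam₂_le := hγ₂bd
      phi₁_le := hφ₁bd
      phi₂_le := hφ₂bd
      gam₁_neg := fun s hs => (hsign s hs).1
      gam₂_pos := fun s hs => (hsign s hs).2
      gam₁_zero := hγ₁0
      gam₁_tb := hγ₁t
      gam₂_zero := hγ₂0
      gam₂_tb := hγ₂t
      phi_zero := hφ0
      phi_tb := hφt
      convex := hconv
      concave := hconc
      lam_mem := hlam_bij.mapsTo
      lam_mono := hlam_mono
      lam_sol := hlam_sol
      lam_zero := hlam0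
      lam_tb := hlamt }
  have hσ : ∀ w ∈ Dr, ∃ s, IsLens.Adm tb γ₁ γ₂ lam s w.1 ∧
      w.2 = lensHeight γ₁ γ₂ φ₁ φ₂ lam s w.1 ∧ ur w = lensGraph γ₁ γ₂ φ₁ φ₂ lam s w.1 := by
    intro w hw
    have hmem : (ur w, w.1, w.2 - 2 * w.1 * ur w) ∈
        heisRho γ₁ γ₂ φ₁ φ₂ lam '' (Set.Ioo (0:ℝ) 1 ×ˢ Set.Ioo (0:ℝ) tb) := by
      rw [hur_graph]
      exact mem_image_of_mem _ hw
    obtain ⟨⟨r, s⟩, ⟨hr, hs⟩, hrs⟩ := hmem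
    obtain ⟨e1, e2⟩ := h.heisRho_eq (r := r) hs rfl
    have hpi : piR (ur w, w.1, w.2 - 2 * w.1 * ur w) = w :=
      Prod.ext rfl (by simp only [piR]; ring)
    rw [hrs] at e1 e2
    rw [hpi] at e2
    have hw1 := congrArg Prod.fst e2
    have hw2 := congrArg Prod.snd e2
    simp only at e1 hw1 hw2
    rw [← hw1] at e1 hw2
    exact ⟨s, hw1 ▸ h.adm_of_param hr hs, hw2, e1⟩
  choose! σ hσ using hσ
  refine h.PerH_le hσ (fun s y hs => ?_) (fun w hw => ?_) hF hK hEK hKD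
  · obtain ⟨r, hr, hy⟩ := h.exists_heisRho_param hs
    rw [hDr, ← (h.heisRho_eq hs.1 hy).2]
    exact mem_image_of_mem _ (mem_image_of_mem _ ⟨hr, hs.1⟩)
  · obtain ⟨ε, hε, k, hk⟩ := hur_lip w hw
    exact ⟨k, _, Filter.inter_mem (mem_nhdsWithin_of_mem_nhds (Metric.ball_mem_nhds w hε))
      self_mem_nhdsWithin, hk⟩
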